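/- arXiv:2007.08923 — 3 statements merged into one kernel-verified Lean document; each statement's English description precedes it below -/
import Mathlib

section
/- Let s ≥ 0 and β ∈ ℝ. There exists C > 0 (depending only on s and β) such that for all t, α ∈ ℝ, all M ≥ 1, and all measurable f, g : ℝ → ℂ with ‖f‖_{L²_s}, ‖g‖_{L²_s} < ∞, writing N[h₁, h₂](ξ) = ∫_ℝ 1{|Φ_β(ξ, ξ₁, ξ − ξ₁) − α| ≤ M} · (iξ) · exp(i t Φ_β(ξ, ξ₁, ξ − ξ₁)) · h₁(ξ₁) · h₂(ξ − ξ₁) dξ₁, one has ‖N[f, f] − N[g, g]‖_{L²_s} ≤ C · M^{1/2} · ‖f − g‖_{L²_s} · (‖f‖_{L²_s} + ‖g‖_{L²_s}). -/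
open MeasureTheory

/-- The Kawahara modulation function. -/
noncomputable def Phi (β ξ ξ₁ ξ₂ : ℝ) : ℝ :=
  ξ₁ ^ 5 + ξ₂ ^ 5 - ξ ^ 5 + β * (ξ₁ ^ 3 + ξ₂ ^ 3 - ξ ^ 3)

/-- The weighted norm `‖f‖_{L²_s} = (∫ ⟨ξ⟩^{2s} |f(ξ)|² dξ)^{1/2}`, with `⟨ξ⟩^{2s} = (1+ξ²)^s`. -/
noncomputable def wnorm (s : ℝ) (f : ℝ → ℂ) : ℝ :=
  (∫ ξ : ℝ, (1 + ξ ^ 2) ^ s * ‖f ξ‖ ^ 2) ^ ((1 : ℝ) / 2)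

/-- The bilinear operator `N^α_{≤M}` (on the Fourier side). -/
noncomputable def Nop (β t α M : ℝ) (h₁ h₂ : ℝ → ℂ) (ξ : ℝ) : ℂ :=
  ∫ ξ₁ : ℝ,
    if |Phi β ξ ξ₁ (ξ - ξ₁) - α| ≤ M then
      Complex.I * (ξ : ℂ) * Complex.exp (Complex.I * (t : ℂ) * ((Phi β ξ ξ₁ (ξ - ξ₁) : ℝ) : ℂ))
        * h₁ ξ₁ * h₂ (ξ - ξ₁)
    else 0

open scoped ENNReal

lemma kw_diffA (β ξ x x' : ℝ) (hK : 4 * (1 + |β|) ≤ |ξ|)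
    (h : |ξ| / 2 ≤ |x + x' - ξ|) :
    5 / 8 * ξ ^ 4 * |x - x'| ≤ |Phi β ξ x (ξ - x) - Phi β ξ x' (ξ - x')| := by
  have e : Phi β ξ x (ξ - x) - Phi β ξ x' (ξ - x') =
      5 * (ξ * ((x - x') * ((x + x' - ξ) *
        ((x - ξ / 2) ^ 2 + (x' - ξ / 2) ^ 2 + ξ ^ 2 / 2 + 3 * β / 5)))) := by
    unfold Phi; ring
  have hb := abs_nonneg β
  have hb2 := neg_abs_le β
  have hsq : |ξ| ^ 2 = ξ ^ 2 := sq_abs ξ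
  have h1 : ξ ^ 2 / 4 ≤ (x - ξ / 2) ^ 2 + (x' - ξ / 2) ^ 2 + ξ ^ 2 / 2 + 3 * β / 5 := by
    nlinarith [sq_nonneg (x - ξ / 2), sq_nonneg (x' - ξ / 2)]
  rw [e]
  simp only [abs_mul]
  have h2 : ξ ^ 2 / 4 ≤ |(x - ξ / 2) ^ 2 + (x' - ξ / 2) ^ 2 + ξ ^ 2 / 2 + 3 * β / 5| :=
    h1.trans (le_abs_self _)
  have h3 : |ξ| / 2 * (ξ ^ 2 / 4) ≤ |x + x' - ξ| *
      |(x - ξ / 2) ^ 2 + (x' - ξ / 2) ^ 2 + ξ ^ 2 / 2 + 3 * β / 5| := by gcongr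
  calc 5 / 8 * ξ ^ 4 * |x - x'|
      = |(5:ℝ)| * (|ξ| * (|x - x'| * (|ξ| / 2 * (ξ ^ 2 / 4)))) := by
        rw [abs_of_pos (by norm_num : (0:ℝ) < 5), show ξ ^ 4 = ξ ^ 2 * ξ ^ 2 by ring]
        nth_rewrite 1 [← hsq]; ring
    _ ≤ _ := by gcongr

lemma kw_aux (p ξ : ℝ) (h : |2 * p - ξ| < |ξ| / 2) :
    |ξ| ≤ 4 * |p| ∧ 0 ≤ ξ * (ξ - p) ∧ (0 < p → p ≤ ξ) ∧ (p < 0 → ξ ≤ p) ∧ p ≠ 0 := by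
  rw [abs_lt] at h
  obtain ⟨h1, h2⟩ := h
  rcases le_total 0 ξ with hx | hx
  · rw [abs_of_nonneg hx] at *
    have : 0 < p := by linarith
    rw [abs_of_pos this]
    refine ⟨by linarith, mul_nonneg hx (by linarith), fun _ => by linarith,
      fun _ => by linarith, this.ne'⟩
  · rw [abs_of_nonpos hx] at *
    have : p < 0 := by linarith
    rw [abs_of_neg this]
    refine ⟨by linarith, mul_nonneg_of_nonpos_of_nonpos hx (by linarith), fun _ => by linarith,
      fun _ => by linarith, this.ne⟩

lemma kw_diffB (β p ξ ξ' : ℝ) (hK : 4 * (1 + |β|) ≤ |ξ|)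
    (h : |2 * p - ξ| < |ξ| / 2) (h' : |2 * p - ξ'| < |ξ'| / 2) :
    p ^ 4 * |ξ - ξ'| ≤ |Phi β ξ p (ξ - p) - Phi β ξ' p (ξ' - p)| := by
  obtain ⟨a1, a2, a3, a4, a5⟩ := kw_aux p ξ h
  obtain ⟨b1, b2, b3, b4, b5⟩ := kw_aux p ξ' h'
  have e : Phi β ξ p (ξ - p) - Phi β ξ' p (ξ' - p) =
      -(p * ((ξ - ξ') * ((ξ + ξ' - p) *
        (5 * p ^ 2 + 3 * β + 5 * (ξ * (ξ - p) + ξ' * (ξ' - p)))))) := by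
    unfold Phi; ring
  have hb := abs_nonneg β
  have hb2 := neg_abs_le β
  have hsq : |p| ^ 2 = p ^ 2 := sq_abs p
  have h1 : p ^ 2 ≤ 5 * p ^ 2 + 3 * β + 5 * (ξ * (ξ - p) + ξ' * (ξ' - p)) := by
    nlinarith
  have h4 : |p| ≤ |ξ + ξ' - p| := by
    rcases lt_or_gt_of_ne a5 with hp | hp
    · have := a4 hp
      have := b4 hp
      rw [abs_of_neg hp, abs_of_neg (by linarith)]; linarith
    · have := a3 hp
      have := b3 hp
      rw [abs_of_pos hp, abs_of_pos (by linarith)]; linarith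
  rw [e, abs_neg]
  simp only [abs_mul]
  have h2 := h1.trans (le_abs_self _)
  calc p ^ 4 * |ξ - ξ'| = |p| * (|ξ - ξ'| * (|p| * p ^ 2)) := by
        rw [show p ^ 4 = p ^ 2 * p ^ 2 by ring]
        nth_rewrite 1 [← hsq]; ring
    _ ≤ _ := by gcongr

lemma kw_vol (T : Set ℝ) (D : ℝ) (h : ∀ x ∈ T, ∀ y ∈ T, |x - y| ≤ D) :
    volume T ≤ ENNReal.ofReal D := by
  refine (Real.volume_le_diam T).trans (Metric.ediam_le ?_)
  intro x hx y hy
  rw [edist_dist, Real.dist_eq]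
  exact ENNReal.ofReal_le_ofReal (h x hx y hy)

lemma kw_cs (f g : ℝ → ℝ≥0∞) (hf : Measurable f) (hg : Measurable g) :
    (∫⁻ x, f x * g x) ^ 2 ≤ (∫⁻ x, f x ^ 2) * ∫⁻ x, g x ^ 2 := by
  have h := ENNReal.lintegral_mul_le_Lp_mul_Lq volume Real.HolderConjugate.two_two
    hf.aemeasurable hg.aemeasurable
  simp only [Pi.mul_apply] at h
  have h2 := pow_le_pow_left' h 2
  refine h2.trans (le_of_eq ?_)
  rw [mul_pow, ← ENNReal.rpow_natCast, ← ENNReal.rpow_natCast, ← ENNReal.rpow_mul,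
    ← ENNReal.rpow_mul]
  norm_num

lemma kw_conv (F G : ℝ → ℝ≥0∞) (hF : Measurable F) (hG : Measurable G) :
    ∫⁻ ξ, ∫⁻ x, F x ^ 2 * G (ξ - x) ^ 2 = (∫⁻ x, F x ^ 2) * ∫⁻ x, G x ^ 2 := by
  rw [lintegral_lintegral_swap (by fun_prop)]
  have : ∀ x, ∫⁻ ξ, F x ^ 2 * G (ξ - x) ^ 2 = F x ^ 2 * ∫⁻ ξ, G ξ ^ 2 := by
    intro x
    rw [lintegral_const_mul _ (by fun_prop), lintegral_sub_right_eq_self (fun ξ => G ξ ^ 2)]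
  simp_rw [this]
  rw [lintegral_mul_const _ (by fun_prop)]

lemma kw_B1 (F G : ℝ → ℝ≥0∞) (hF : Measurable F) (hG : Measurable G) (k : ℝ × ℝ → ℝ≥0∞)
    (hk : Measurable k) (A : ℝ≥0∞) (h : ∀ ξ, ∫⁻ x, k (ξ, x) ^ 2 ≤ A) :
    ∫⁻ ξ, (∫⁻ x, k (ξ, x) * (F x * G (ξ - x))) ^ 2
      ≤ A * ((∫⁻ x, F x ^ 2) * ∫⁻ x, G x ^ 2) := by
  calc _ ≤ ∫⁻ ξ, A * ∫⁻ x, F x ^ 2 * G (ξ - x) ^ 2 := by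
        refine lintegral_mono fun ξ => ?_
        refine (kw_cs _ _ (by fun_prop) (by fun_prop)).trans ?_
        simp only [mul_pow]
        gcongr
        exact h ξ
    _ = _ := by
        rw [lintegral_const_mul, kw_conv F G hF hG]
        exact Measurable.lintegral_prod_right' (f := fun p : ℝ × ℝ => F p.2 ^ 2 * G (p.1 - p.2) ^ 2)
          (by fun_prop)

lemma kw_B2 (F G : ℝ → ℝ≥0∞) (hF : Measurable F) (hG : Measurable G) (k : ℝ × ℝ → ℝ≥0∞)
    (hk : Measurable k) (A : ℝ≥0∞) (h : ∀ x, ∫⁻ ξ, k (ξ, x) ^ 2 ≤ A) :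
    ∫⁻ ξ, (∫⁻ x, k (ξ, x) * (F x * G (ξ - x))) ^ 2
      ≤ A * ((∫⁻ x, F x ^ 2) * ∫⁻ x, G x ^ 2) := by
  have hm : Measurable fun p : ℝ × ℝ => (k p * F p.2) ^ 2 := by fun_prop
  calc _ ≤ ∫⁻ ξ, (∫⁻ x, (k (ξ, x) * F x) ^ 2) * ∫⁻ x, G x ^ 2 := by
        refine lintegral_mono fun ξ => ?_
        simp only [← mul_assoc]
        refine (kw_cs _ _ (by fun_prop) (by fun_prop)).trans ?_
        rw [lintegral_sub_left_eq_self (fun x => G x ^ 2)]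
    _ = (∫⁻ x, ∫⁻ ξ, (k (ξ, x) * F x) ^ 2) * ∫⁻ x, G x ^ 2 := by
        rw [lintegral_mul_const, lintegral_lintegral_swap (by fun_prop)]
        exact Measurable.lintegral_prod_right' hm
    _ ≤ (∫⁻ x, A * F x ^ 2) * ∫⁻ x, G x ^ 2 := by
        gcongr with x
        simp only [mul_pow]
        rw [lintegral_mul_const _ (by fun_prop)]
        gcongr
        exact h x
    _ = _ := by
        rw [lintegral_const_mul _ (by fun_prop), mul_assoc]

/-- The modulation region. -/
def kwS (β α M : ℝ) : Set (ℝ × ℝ) := {p | |Phi β p.1 p.2 (p.1 - p.2) - α| ≤ M}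

/-- The high-frequency, non-diagonal region. -/
def kwR (β : ℝ) : Set (ℝ × ℝ) :=
  {p | 4 * (1 + |β|) ≤ |p.1| ∧ |p.1| / 2 ≤ |2 * p.2 - p.1|}

lemma kwS_meas (β α M : ℝ) : MeasurableSet (kwS β α M) := by
  unfold kwS Phi
  apply measurableSet_le <;> fun_prop

lemma kwR_meas (β : ℝ) : MeasurableSet (kwR β) := by
  unfold kwR
  apply MeasurableSet.inter
  · exact (measurableSet_le (by fun_prop) (by fun_prop) : MeasurableSet {p : ℝ × ℝ | 4 * (1 + |β|) ≤ |p.1|})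
  · exact (measurableSet_le (by fun_prop) (by fun_prop) : MeasurableSet {p : ℝ × ℝ | |p.1| / 2 ≤ |2 * p.2 - p.1|})

lemma kw_vol1 (β α M ξ : ℝ) (hM : 1 ≤ M) (hK : 4 * (1 + |β|) ≤ |ξ|) (T : Set ℝ)
    (hT : ∀ x ∈ T, (ξ, x) ∈ kwS β α M) (hT2 : ∀ x ∈ T, ∀ y ∈ T, |ξ| / 2 ≤ |x + y - ξ|) :
    volume T ≤ ENNReal.ofReal (4 * M / ξ ^ 2) := by
  apply kw_vol
  intro x hx y hy
  have h1 := kw_diffA β ξ x y hK (hT2 x hx y hy)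
  have h2 := hT x hx
  have h3 := hT y hy
  simp only [kwS, Set.mem_ofPred_eq] at h2 h3
  have h4 : |Phi β ξ x (ξ - x) - Phi β ξ y (ξ - y)| ≤ 2 * M := by
    rw [abs_le] at *; constructor <;> linarith
  have hb := abs_nonneg β
  have hsq : |ξ| ^ 2 = ξ ^ 2 := sq_abs ξ
  have hx1 : 1 ≤ ξ ^ 2 := by nlinarith
  rw [le_div_iff₀ (by linarith)]
  have h5 : ξ ^ 2 ≤ ξ ^ 4 := by nlinarith
  nlinarith [mul_le_mul_of_nonneg_right h5 (abs_nonneg (x - y))]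

lemma kw_k1 (β α M : ℝ) (hM : 1 ≤ M) (ξ : ℝ) :
    ∫⁻ x, ((kwS β α M ∩ kwR β).indicator (fun p => ENNReal.ofReal |p.1|) (ξ, x)) ^ 2
      ≤ ENNReal.ofReal (8 * M) := by
  by_cases hK : 4 * (1 + |β|) ≤ |ξ|
  swap
  · have : ∀ x, ((kwS β α M ∩ kwR β).indicator (fun p => ENNReal.ofReal |p.1|) (ξ, x)) ^ 2 = 0 := by
      intro x
      rw [Set.indicator_of_notMem (fun h => hK h.2.1)]; simp
    simp [this]
  set T1 : Set ℝ := {x | (ξ, x) ∈ kwS β α M ∧ |ξ| / 2 ≤ 2 * x - ξ} with hT1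
  set T2 : Set ℝ := {x | (ξ, x) ∈ kwS β α M ∧ |ξ| / 2 ≤ -(2 * x - ξ)} with hT2
  have v1 : volume T1 ≤ ENNReal.ofReal (4 * M / ξ ^ 2) := by
    apply kw_vol1 β α M ξ hM hK T1 (fun x hx => hx.1)
    intro x hx y hy
    have := hx.2
    have := hy.2
    refine le_trans ?_ (le_abs_self _)
    linarith
  have v2 : volume T2 ≤ ENNReal.ofReal (4 * M / ξ ^ 2) := by
    apply kw_vol1 β α M ξ hM hK T2 (fun x hx => hx.1)
    intro x hx y hy
    have := hx.2
    have := hy.2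
    refine le_trans ?_ (neg_le_abs _)
    linarith
  have hb := abs_nonneg β
  have hsq : |ξ| ^ 2 = ξ ^ 2 := sq_abs ξ
  have hx1 : 1 ≤ ξ ^ 2 := by nlinarith
  have hms : MeasurableSet (T1 ∪ T2) := by
    have hs : MeasurableSet {x | (ξ, x) ∈ kwS β α M} :=
      (kwS_meas β α M).preimage measurable_prodMk_left
    refine MeasurableSet.union (hs.inter ?_) (hs.inter ?_)
    · exact (measurableSet_le (by fun_prop) (by fun_prop) : MeasurableSet {x : ℝ | |ξ| / 2 ≤ 2 * x - ξ})
    · exact (measurableSet_le (by fun_prop) (by fun_prop) : MeasurableSet {x : ℝ | |ξ| / 2 ≤ -(2 * x - ξ)})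
  calc _ ≤ ∫⁻ x, (T1 ∪ T2).indicator (fun _ => ENNReal.ofReal (ξ ^ 2)) x := by
        refine lintegral_mono fun x => ?_
        by_cases hx : (ξ, x) ∈ kwS β α M ∩ kwR β
        · rw [Set.indicator_of_mem hx, Set.indicator_of_mem, ← ENNReal.ofReal_pow (abs_nonneg _),
            hsq]
          rcases le_abs.1 hx.2.2 with h | h
          · exact Or.inl ⟨hx.1, h⟩
          · exact Or.inr ⟨hx.1, h⟩
        · rw [Set.indicator_of_notMem hx]; simp
    _ = ENNReal.ofReal (ξ ^ 2) * volume (T1 ∪ T2) := lintegral_indicator_const hms _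
    _ ≤ ENNReal.ofReal (ξ ^ 2) *
        (ENNReal.ofReal (4 * M / ξ ^ 2) + ENNReal.ofReal (4 * M / ξ ^ 2)) := by
        gcongr
        exact (measure_union_le _ _).trans (add_le_add v1 v2)
    _ = _ := by
        rw [← ENNReal.ofReal_add (by positivity) (by positivity),
          ← ENNReal.ofReal_mul (by positivity)]
        congr 1
        have : ξ ≠ 0 := by rintro rfl; norm_num at hx1
        field_simp; ring

lemma kw_k2 (β α M : ℝ) (hM : 1 ≤ M) (p : ℝ) :
    ∫⁻ ξ, ((kwS β α M ∩ (kwR β)ᶜ).indicator (fun p => ENNReal.ofReal |p.1|) (ξ, p)) ^ 2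
      ≤ ENNReal.ofReal ((2 * (4 * (1 + |β|)) ^ 3 + 32) * M) := by
  set K := 4 * (1 + |β|) with hKdef
  have hb := abs_nonneg β
  set T : Set ℝ := {ξ | (ξ, p) ∈ kwS β α M ∧ K ≤ |ξ| ∧ |2 * p - ξ| < |ξ| / 2} with hT
  have hmT : MeasurableSet T := by
    have hs : MeasurableSet {x | (x, p) ∈ kwS β α M} :=
      (kwS_meas β α M).preimage measurable_prodMk_right
    refine MeasurableSet.inter hs (MeasurableSet.inter ?_ ?_)
    · exact (measurableSet_le (by fun_prop) (by fun_prop) : MeasurableSet {x : ℝ | K ≤ |x|})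
    · exact (measurableSet_lt (by fun_prop) (by fun_prop) : MeasurableSet {x : ℝ | |2 * p - x| < |x| / 2})
  have hv : ENNReal.ofReal (16 * p ^ 2) * volume T ≤ ENNReal.ofReal (32 * M) := by
    rcases T.eq_empty_or_nonempty with h0 | ⟨ξ, hξ⟩
    · simp [h0]
    obtain ⟨a1, -⟩ := kw_aux p ξ hξ.2.2
    have hp1 : 1 ≤ |p| := by
      have := hξ.2.1
      linarith
    have hp2 : 1 ≤ p ^ 2 := by rw [← sq_abs]; nlinarith
    have : volume T ≤ ENNReal.ofReal (2 * M / p ^ 2) := by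
      apply kw_vol
      intro x hx y hy
      have h1 := kw_diffB β p x y hx.2.1 hx.2.2 hy.2.2
      have h2 := hx.1
      have h3 := hy.1
      simp only [kwS, Set.mem_ofPred_eq] at h2 h3
      have h4 : |Phi β x p (x - p) - Phi β y p (y - p)| ≤ 2 * M := by
        rw [abs_le] at *; constructor <;> linarith
      rw [le_div_iff₀ (by linarith)]
      have h5 : p ^ 2 ≤ p ^ 4 := by nlinarith
      nlinarith [mul_le_mul_of_nonneg_right h5 (abs_nonneg (x - y))]
    calc _ ≤ ENNReal.ofReal (16 * p ^ 2) * ENNReal.ofReal (2 * M / p ^ 2) := by gcongr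
      _ = _ := by
        rw [← ENNReal.ofReal_mul (by positivity)]
        congr 1
        have : p ≠ 0 := by rintro rfl; norm_num at hp2
        field_simp; ring
  calc _ ≤ ∫⁻ ξ, ((Set.Icc (-K) K).indicator (fun _ => ENNReal.ofReal (K ^ 2)) ξ
            + T.indicator (fun _ => ENNReal.ofReal (16 * p ^ 2)) ξ) := by
        refine lintegral_mono fun ξ => ?_
        by_cases hx : (ξ, p) ∈ kwS β α M ∩ (kwR β)ᶜ
        · rw [Set.indicator_of_mem hx]
          simp only
          rw [← ENNReal.ofReal_pow (abs_nonneg _)]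
          by_cases hk : |ξ| ≤ K
          · refine le_trans ?_ le_self_add
            rw [Set.indicator_of_mem (by rwa [Set.mem_Icc, ← abs_le])]
            gcongr
          · refine le_trans ?_ le_add_self
            have hxT : ξ ∈ T := by
              refine ⟨hx.1, by linarith, ?_⟩
              by_contra hc
              exact hx.2 ⟨by simp only; linarith, not_lt.1 hc⟩
            rw [Set.indicator_of_mem hxT]
            apply ENNReal.ofReal_le_ofReal
            have := (kw_aux p ξ hxT.2.2).1
            rw [← sq_abs p]
            nlinarith [abs_nonneg ξ]
        · rw [Set.indicator_of_notMem hx]; simp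
    _ = ENNReal.ofReal (K ^ 2) * volume (Set.Icc (-K) K)
        + ENNReal.ofReal (16 * p ^ 2) * volume T := by
        rw [lintegral_add_left (measurable_const.indicator measurableSet_Icc),
          lintegral_indicator_const measurableSet_Icc, lintegral_indicator_const hmT]
    _ ≤ ENNReal.ofReal (K ^ 2 * (2 * K)) + ENNReal.ofReal (32 * M) := by
        rw [Real.volume_Icc, ← ENNReal.ofReal_mul (by positivity)]
        gcongr
        apply le_of_eq; ring
    _ ≤ _ := by
        have : 0 < K := by positivity
        rw [← ENNReal.ofReal_add (by positivity) (by positivity)]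
        apply ENNReal.ofReal_le_ofReal
        have : 0 ≤ 2 * K ^ 3 := by positivity
        nlinarith

lemma kw_B (β α M : ℝ) (hM : 1 ≤ M) (F G : ℝ → ℝ≥0∞) (hF : Measurable F) (hG : Measurable G) :
    ∫⁻ ξ, (∫⁻ x, (kwS β α M).indicator (fun p => ENNReal.ofReal |p.1|) (ξ, x) *
        (F x * G (ξ - x))) ^ 2
      ≤ ENNReal.ofReal (4 * (2 * (4 * (1 + |β|)) ^ 3 + 32) * M) *
        ((∫⁻ x, F x ^ 2) * ∫⁻ x, G x ^ 2) := by
  set A := (2 * (4 * (1 + |β|)) ^ 3 + 32) with hA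
  have hA0 : 32 ≤ A := by have := abs_nonneg β; rw [hA]; linarith [show 0 ≤ 2 * (4 * (1 + |β|)) ^ 3 by positivity]
  set k1 := (kwS β α M ∩ kwR β).indicator (fun p => ENNReal.ofReal |p.1|) with hk1
  set k2 := (kwS β α M ∩ (kwR β)ᶜ).indicator (fun p => ENNReal.ofReal |p.1|) with hk2
  have hm1 : Measurable k1 := Measurable.indicator (by fun_prop)
    ((kwS_meas β α M).inter (kwR_meas β))
  have hm2 : Measurable k2 := Measurable.indicator (by fun_prop)
    ((kwS_meas β α M).inter (kwR_meas β).compl)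
  have hsum : ∀ p, (kwS β α M).indicator (fun p => ENNReal.ofReal |p.1|) p = k1 p + k2 p := by
    intro p
    by_cases h1 : p ∈ kwS β α M <;> by_cases h2 : p ∈ kwR β <;>
      simp [hk1, hk2, Set.indicator, h1, h2]
  have b1 := kw_B1 F G hF hG k1 hm1 (ENNReal.ofReal (A * M)) (fun ξ =>
    (kw_k1 β α M hM ξ).trans (ENNReal.ofReal_le_ofReal (by nlinarith)))
  have b2 := kw_B2 F G hF hG k2 hm2 (ENNReal.ofReal (A * M)) (kw_k2 β α M hM)
  have sq : ∀ a b : ℝ≥0∞, (a + b) ^ 2 ≤ 2 * (a ^ 2 + b ^ 2) := by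
    intro a b
    have := ENNReal.rpow_add_le_mul_rpow_add_rpow a b (p := 2) (by norm_num)
    norm_num at this
    exact this
  calc _ ≤ ∫⁻ ξ, 2 * ((∫⁻ x, k1 (ξ, x) * (F x * G (ξ - x))) ^ 2 +
          (∫⁻ x, k2 (ξ, x) * (F x * G (ξ - x))) ^ 2) := by
        refine lintegral_mono fun ξ => ?_
        simp only [hsum, add_mul]
        rw [lintegral_add_left (by fun_prop)]
        exact sq _ _
    _ = 2 * ((∫⁻ ξ, (∫⁻ x, k1 (ξ, x) * (F x * G (ξ - x))) ^ 2) +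
          ∫⁻ ξ, (∫⁻ x, k2 (ξ, x) * (F x * G (ξ - x))) ^ 2) := by
        have c1 : Measurable fun ξ => ∫⁻ x, k1 (ξ, x) * (F x * G (ξ - x)) :=
          Measurable.lintegral_prod_right' (f := fun p : ℝ × ℝ => k1 p * (F p.2 * G (p.1 - p.2)))
            (by fun_prop)
        have c2 : Measurable fun ξ => ∫⁻ x, k2 (ξ, x) * (F x * G (ξ - x)) :=
          Measurable.lintegral_prod_right' (f := fun p : ℝ × ℝ => k2 p * (F p.2 * G (p.1 - p.2)))
            (by fun_prop)
        rw [lintegral_const_mul _ (by fun_prop), lintegral_add_left (by fun_prop)]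
    _ ≤ 2 * (ENNReal.ofReal (A * M) * ((∫⁻ x, F x ^ 2) * ∫⁻ x, G x ^ 2) +
          ENNReal.ofReal (A * M) * ((∫⁻ x, F x ^ 2) * ∫⁻ x, G x ^ 2)) := by gcongr
    _ = _ := by
        rw [show 4 * A * M = 4 * (A * M) by ring, ENNReal.ofReal_mul (by norm_num : (0:ℝ) ≤ 4)]
        rw [show ENNReal.ofReal 4 = 4 by norm_num]
        ring

/-- Weighted modulus. -/
noncomputable def kwH (s : ℝ) (h : ℝ → ℂ) (ξ : ℝ) : ℝ≥0∞ :=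
  ENNReal.ofReal ((1 + ξ ^ 2) ^ (s / 2)) * ‖h ξ‖ₑ

lemma kwH_meas (s : ℝ) (h : ℝ → ℂ) (hh : Measurable h) : Measurable (kwH s h) := by
  unfold kwH; fun_prop

lemma kwH_sq (s : ℝ) (h : ℝ → ℂ) (ξ : ℝ) :
    kwH s h ξ ^ 2 = ENNReal.ofReal ((1 + ξ ^ 2) ^ s * ‖h ξ‖ ^ 2) := by
  unfold kwH
  have h0 : (0:ℝ) ≤ 1 + ξ ^ 2 := by positivity
  rw [← ofReal_norm, ← ENNReal.ofReal_mul (by positivity),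
    ← ENNReal.ofReal_pow (by positivity), mul_pow, ← Real.rpow_natCast ((1 + ξ ^ 2) ^ (s / 2)),
    ← Real.rpow_mul h0]
  congr 4
  push_cast; ring

lemma kw_weight (s : ℝ) (hs : 0 ≤ s) (ξ x : ℝ) :
    ENNReal.ofReal ((1 + ξ ^ 2) ^ (s / 2)) ≤ ENNReal.ofReal (2 ^ (s / 2)) *
      (ENNReal.ofReal ((1 + x ^ 2) ^ (s / 2)) * ENNReal.ofReal ((1 + (ξ - x) ^ 2) ^ (s / 2))) := by
  rw [← ENNReal.ofReal_mul (by positivity), ← ENNReal.ofReal_mul (by positivity)]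
  apply ENNReal.ofReal_le_ofReal
  rw [← Real.mul_rpow (by positivity) (by positivity), ← Real.mul_rpow (by positivity) (by positivity)]
  apply Real.rpow_le_rpow (by positivity) _ (by positivity)
  nlinarith [sq_nonneg (x - (ξ - x)), mul_nonneg (sq_nonneg x) (sq_nonneg (ξ - x))]

lemma kw_memLp (s : ℝ) (hs : 0 ≤ s) (f : ℝ → ℂ) (hf : Measurable f)
    (hi : Integrable (fun ξ : ℝ => (1 + ξ ^ 2) ^ s * ‖f ξ‖ ^ 2)) : MemLp f 2 := by
  rw [memLp_two_iff_integrable_sq_norm hf.aestronglyMeasurable]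
  refine hi.mono' (by fun_prop) (Filter.Eventually.of_forall fun ξ => ?_)
  rw [Real.norm_of_nonneg (by positivity)]
  have : 1 ≤ (1 + ξ ^ 2) ^ s := Real.one_le_rpow (by nlinarith [sq_nonneg ξ]) hs
  nlinarith [sq_nonneg ‖f ξ‖]

/-- The integrand of `Nop`. -/
noncomputable def kwI (β t α M : ℝ) (h₁ h₂ : ℝ → ℂ) (ξ ξ₁ : ℝ) : ℂ :=
    if |Phi β ξ ξ₁ (ξ - ξ₁) - α| ≤ M then
      Complex.I * (ξ : ℂ) * Complex.exp (Complex.I * (t : ℂ) * ((Phi β ξ ξ₁ (ξ - ξ₁) : ℝ) : ℂ))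
        * h₁ ξ₁ * h₂ (ξ - ξ₁)
    else 0

lemma kw_coef (ξ t r : ℝ) :
    ‖Complex.I * (ξ : ℂ) * Complex.exp (Complex.I * (t : ℂ) * ((r : ℝ) : ℂ))‖ = |ξ| := by
  have : Complex.I * (t : ℂ) * ((r : ℝ) : ℂ) = ((t * r : ℝ) : ℂ) * Complex.I := by
    push_cast; ring
  rw [norm_mul, norm_mul, this, Complex.norm_exp_ofReal_mul_I]
  simp

lemma kwI_int (β t α M : ℝ) (f : ℝ → ℂ) (hf : Measurable f) (h2 : MemLp f 2) (ξ : ℝ) :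
    Integrable (kwI β t α M f f ξ) := by
  have h3 : MemLp (fun x => f (ξ - x)) 2 :=
    h2.comp_measurePreserving (Measure.measurePreserving_sub_left volume ξ)
  have h4 : Integrable (fun x => f x * f (ξ - x)) := h2.integrable_mul h3
  refine (h4.norm.const_mul |ξ|).mono' ?_ (Filter.Eventually.of_forall fun x => ?_)
  · apply Measurable.aestronglyMeasurable
    unfold kwI Phi
    refine Measurable.ite (measurableSet_le (by fun_prop) (by fun_prop)) (by fun_prop) (by fun_prop)
  · unfold kwI
    split_ifs
    · rw [mul_assoc, norm_mul, kw_coef]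
    · simp only [norm_zero]; positivity

lemma kwI_diff (β t α M : ℝ) (f g : ℝ → ℂ) (ξ x : ℝ) :
    ‖kwI β t α M f f ξ x - kwI β t α M g g ξ x‖ₑ ≤
      (kwS β α M).indicator (fun p => ENNReal.ofReal |p.1|) (ξ, x) *
        (‖f x - g x‖ₑ * ‖f (ξ - x)‖ₑ + ‖g x‖ₑ * ‖f (ξ - x) - g (ξ - x)‖ₑ) := by
  by_cases h : |Phi β ξ x (ξ - x) - α| ≤ M
  · rw [Set.indicator_of_mem (show (ξ, x) ∈ kwS β α M from h)]
    simp only [kwI, if_pos h]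
    set c := Complex.I * (ξ : ℂ) * Complex.exp (Complex.I * (t : ℂ) * ((Phi β ξ x (ξ - x) : ℝ) : ℂ))
      with hc
    have e : c * f x * f (ξ - x) - c * g x * g (ξ - x) =
        c * ((f x - g x) * f (ξ - x) + g x * (f (ξ - x) - g (ξ - x))) := by ring
    rw [e, enorm_mul, ← ofReal_norm c, hc, kw_coef]
    gcongr
    refine (enorm_add_le _ _).trans ?_
    rw [enorm_mul, enorm_mul]
  · simp only [kwI, if_neg h]
    simp

lemma kw_sq_add (a b : ℝ≥0∞) : (a + b) ^ 2 ≤ 2 * (a ^ 2 + b ^ 2) := by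
  have := ENNReal.rpow_add_le_mul_rpow_add_rpow a b (p := 2) (by norm_num)
  norm_num at this
  exact this

lemma kw_pt (s β t α M : ℝ) (hs : 0 ≤ s) (f g : ℝ → ℂ) (hf : Measurable f) (hg : Measurable g)
    (hf2 : MemLp f 2) (hg2 : MemLp g 2) (ξ : ℝ) :
    kwH s (fun ξ => Nop β t α M f f ξ - Nop β t α M g g ξ) ξ ≤ ENNReal.ofReal (2 ^ (s / 2)) *
      ((∫⁻ x, (kwS β α M).indicator (fun p => ENNReal.ofReal |p.1|) (ξ, x) *
        (kwH s (fun ξ => f ξ - g ξ) x * kwH s f (ξ - x))) +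
       (∫⁻ x, (kwS β α M).indicator (fun p => ENNReal.ofReal |p.1|) (ξ, x) *
        (kwH s g x * kwH s (fun ξ => f ξ - g ξ) (ξ - x)))) := by
  have hk : Measurable ((kwS β α M).indicator (fun p => ENNReal.ofReal |p.1|)) :=
    Measurable.indicator (by fun_prop) (kwS_meas β α M)
  have m1 := kwH_meas s (fun ξ => f ξ - g ξ) (hf.sub hg)
  have m2 := kwH_meas s f hf
  have m3 := kwH_meas s g hg
  have e : Nop β t α M f f ξ - Nop β t α M g g ξ =
      ∫ x, (kwI β t α M f f ξ x - kwI β t α M g g ξ x) := by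
    rw [integral_sub (kwI_int β t α M f hf hf2 ξ) (kwI_int β t α M g hg hg2 ξ)]
    rfl
  rw [← lintegral_add_left (by fun_prop), ← lintegral_const_mul _ (by fun_prop)]
  rw [kwH, e]
  calc _ ≤ ENNReal.ofReal ((1 + ξ ^ 2) ^ (s / 2)) *
        ∫⁻ x, ‖kwI β t α M f f ξ x - kwI β t α M g g ξ x‖ₑ := by
        gcongr
        exact enorm_integral_le_lintegral_enorm _
    _ = ∫⁻ x, ENNReal.ofReal ((1 + ξ ^ 2) ^ (s / 2)) *
        ‖kwI β t α M f f ξ x - kwI β t α M g g ξ x‖ₑ := by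
        rw [lintegral_const_mul' _ _ ENNReal.ofReal_ne_top]
    _ ≤ _ := by
        refine lintegral_mono fun x => ?_
        refine (mul_le_mul' (kw_weight s hs ξ x) (kwI_diff β t α M f g ξ x)).trans (le_of_eq ?_)
        simp only [kwH]
        ring

lemma kw_lint (s : ℝ) (f : ℝ → ℂ)
    (hi : Integrable (fun ξ : ℝ => (1 + ξ ^ 2) ^ s * ‖f ξ‖ ^ 2)) :
    ∫⁻ x, kwH s f x ^ 2 = ENNReal.ofReal (∫ ξ : ℝ, (1 + ξ ^ 2) ^ s * ‖f ξ‖ ^ 2) := by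
  simp_rw [kwH_sq]
  rw [ofReal_integral_eq_lintegral_ofReal hi]
  exact Filter.Eventually.of_forall fun ξ => by positivity

lemma kw_lint' (s : ℝ) (f : ℝ → ℂ) :
    ENNReal.ofReal (∫ ξ : ℝ, (1 + ξ ^ 2) ^ s * ‖f ξ‖ ^ 2) ≤ ∫⁻ x, kwH s f x ^ 2 := by
  have h0 : 0 ≤ ∫ ξ : ℝ, (1 + ξ ^ 2) ^ s * ‖f ξ‖ ^ 2 :=
    integral_nonneg fun ξ => by positivity
  have h := enorm_integral_le_lintegral_enorm (μ := volume)
    (fun ξ : ℝ => (1 + ξ ^ 2) ^ s * ‖f ξ‖ ^ 2)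
  rw [Real.enorm_of_nonneg h0] at h
  refine h.trans (le_of_eq (lintegral_congr fun ξ => ?_))
  rw [kwH_sq, Real.enorm_of_nonneg (by positivity)]

/-- Estimate (nmd) of Proposition 3.1: the difference bound
`‖N^α_{≤M}(f,f) − N^α_{≤M}(g,g)‖_{H^s} ≲ M^{1/2} ‖f − g‖_{H^s} (‖f‖_{H^s} + ‖g‖_{H^s})`. -/
theorem kawahara_N_leM_difference_estimate (s β : ℝ) (hs : 0 ≤ s) :
    ∃ C > 0, ∀ (t α M : ℝ), 1 ≤ M → ∀ f g : ℝ → ℂ,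
      Measurable f → Measurable g →
      Integrable (fun ξ : ℝ => (1 + ξ ^ 2) ^ s * ‖f ξ‖ ^ 2) →
      Integrable (fun ξ : ℝ => (1 + ξ ^ 2) ^ s * ‖g ξ‖ ^ 2) →
      wnorm s (fun ξ : ℝ => Nop β t α M f f ξ - Nop β t α M g g ξ)
        ≤ C * M ^ ((1 : ℝ) / 2) * wnorm s (fun ξ => f ξ - g ξ) * (wnorm s f + wnorm s g) := by
  set B : ℝ := 4 * (2 * (4 * (1 + |β|)) ^ 3 + 32) with hB
  have hB0 : 0 < B := by have := abs_nonneg β; positivity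
  refine ⟨Real.sqrt (2 * 2 ^ s * B), Real.sqrt_pos.2 (by positivity), ?_⟩
  intro t α M hM f g hf hg hfi hgi
  have hdi : Integrable (fun ξ : ℝ => (1 + ξ ^ 2) ^ s * ‖f ξ - g ξ‖ ^ 2) := by
    refine ((hfi.add hgi).const_mul 2).mono' (by fun_prop) (Filter.Eventually.of_forall fun ξ => ?_)
    rw [Real.norm_of_nonneg (by positivity)]
    have h1 : ‖f ξ - g ξ‖ ^ 2 ≤ 2 * (‖f ξ‖ ^ 2 + ‖g ξ‖ ^ 2) := by
      have := norm_sub_le (f ξ) (g ξ)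
      nlinarith [norm_nonneg (f ξ - g ξ), sq_nonneg (‖f ξ‖ - ‖g ξ‖)]
    have h2 : 0 ≤ (1 + ξ ^ 2) ^ s := by positivity
    simp only [Pi.add_apply]
    nlinarith [mul_le_mul_of_nonneg_left h1 h2]
  have m1 := kwH_meas s (fun ξ => f ξ - g ξ) (hf.sub hg)
  have m2 := kwH_meas s f hf
  have m3 := kwH_meas s g hg
  have b1 := kw_B β α M hM _ _ m1 m2
  have b2 := kw_B β α M hM _ _ m3 m1
  rw [kw_lint s _ hdi] at b1 b2
  rw [kw_lint s f hfi] at b1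
  rw [kw_lint s g hgi] at b2
  rw [← hB] at b1 b2
  unfold wnorm
  set If := ∫ ξ : ℝ, (1 + ξ ^ 2) ^ s * ‖f ξ‖ ^ 2 with hIf
  set Ig := ∫ ξ : ℝ, (1 + ξ ^ 2) ^ s * ‖g ξ‖ ^ 2 with hIg
  set Id := ∫ ξ : ℝ, (1 + ξ ^ 2) ^ s * ‖f ξ - g ξ‖ ^ 2 with hId
  have pf : 0 ≤ If := integral_nonneg fun ξ => by positivity
  have pg : 0 ≤ Ig := integral_nonneg fun ξ => by positivity
  have pd : 0 ≤ Id := integral_nonneg fun ξ => by positivity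
  have hk : Measurable ((kwS β α M).indicator (fun p => ENNReal.ofReal |p.1|)) :=
    Measurable.indicator (by fun_prop) (kwS_meas β α M)
  have key : ENNReal.ofReal
      (∫ ξ : ℝ, (1 + ξ ^ 2) ^ s * ‖Nop β t α M f f ξ - Nop β t α M g g ξ‖ ^ 2) ≤
      ENNReal.ofReal (2 * 2 ^ s * B * M * Id * (If + Ig)) := by
    set P := fun ξ => ∫⁻ x, (kwS β α M).indicator (fun p => ENNReal.ofReal |p.1|) (ξ, x) *
        (kwH s (fun ξ => f ξ - g ξ) x * kwH s f (ξ - x)) with hP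
    set Q := fun ξ => ∫⁻ x, (kwS β α M).indicator (fun p => ENNReal.ofReal |p.1|) (ξ, x) *
        (kwH s g x * kwH s (fun ξ => f ξ - g ξ) (ξ - x)) with hQ
    have mP : Measurable P := Measurable.lintegral_prod_right' (f := fun p : ℝ × ℝ =>
      (kwS β α M).indicator (fun p => ENNReal.ofReal |p.1|) p *
        (kwH s (fun ξ => f ξ - g ξ) p.2 * kwH s f (p.1 - p.2))) (by fun_prop)
    have mQ : Measurable Q := Measurable.lintegral_prod_right' (f := fun p : ℝ × ℝ =>
      (kwS β α M).indicator (fun p => ENNReal.ofReal |p.1|) p *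
        (kwH s g p.2 * kwH s (fun ξ => f ξ - g ξ) (p.1 - p.2))) (by fun_prop)
    have hc : ENNReal.ofReal (2 ^ (s / 2)) ^ 2 = ENNReal.ofReal (2 ^ s) := by
      rw [← ENNReal.ofReal_pow (by positivity), ← Real.rpow_natCast, ← Real.rpow_mul (by norm_num)]
      congr 2
      push_cast; ring
    refine (kw_lint' s (fun ξ => Nop β t α M f f ξ - Nop β t α M g g ξ)).trans ?_
    calc _ ≤ ∫⁻ ξ, ENNReal.ofReal (2 ^ s) * (2 * (P ξ ^ 2 + Q ξ ^ 2)) := by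
          refine lintegral_mono fun ξ => ?_
          have h := kw_pt s β t α M hs f g hf hg (kw_memLp s hs f hf hfi) (kw_memLp s hs g hg hgi) ξ
          refine (pow_le_pow_left' h 2).trans ?_
          rw [mul_pow, hc]
          gcongr
          exact kw_sq_add _ _
      _ = ENNReal.ofReal (2 ^ s) * (2 * ((∫⁻ ξ, P ξ ^ 2) + ∫⁻ ξ, Q ξ ^ 2)) := by
          rw [lintegral_const_mul _ (by fun_prop), lintegral_const_mul _ (by fun_prop),
            lintegral_add_left (by fun_prop)]
      _ ≤ ENNReal.ofReal (2 ^ s) * (2 * (ENNReal.ofReal (B * M) *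
          (ENNReal.ofReal Id * ENNReal.ofReal If) + ENNReal.ofReal (B * M) *
          (ENNReal.ofReal Ig * ENNReal.ofReal Id))) := by
          gcongr
      _ = _ := by
          rw [show (2 : ℝ≥0∞) = ENNReal.ofReal 2 by norm_num]
          rw [← ENNReal.ofReal_mul pd, ← ENNReal.ofReal_mul pg,
            ← ENNReal.ofReal_mul (by positivity), ← ENNReal.ofReal_mul (by positivity),
            ← ENNReal.ofReal_add (by positivity) (by positivity),
            ← ENNReal.ofReal_mul (by positivity), ← ENNReal.ofReal_mul (by positivity)]
          congr 1
          ring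
  have key2 := (ENNReal.ofReal_le_ofReal_iff (by positivity)).1 key
  simp only [← Real.sqrt_eq_rpow]
  refine (Real.sqrt_le_sqrt key2).trans ?_
  rw [Real.sqrt_mul (by positivity), Real.sqrt_mul (by positivity), Real.sqrt_mul (by positivity)]
  gcongr
  rw [Real.sqrt_le_left (by positivity)]
  nlinarith [Real.sq_sqrt pf, Real.sq_sqrt pg, Real.sqrt_nonneg If, Real.sqrt_nonneg Ig,
    mul_nonneg (Real.sqrt_nonneg If) (Real.sqrt_nonneg Ig)]
end

section
/- Let s ≥ 0 and β ∈ ℝ. There exists C > 0 (depending only on s and β) such that for all t, α ∈ ℝ, all M ≥ 1, and all measurable f, g : ℝ → ℂ with ‖f‖_{L²_s}, ‖g‖_{L²_s} < ∞, the function F(ξ) = ∫_ℝ 1{|Φ_β(ξ, ξ₁, ξ − ξ₁) − α| > M} · (iξ) · exp(i t Φ_β(ξ, ξ₁, ξ − ξ₁)) / (Φ_β(ξ, ξ₁, ξ − ξ₁) − α) · f(ξ₁) · g(ξ − ξ₁) dξ₁ satisfies ‖F‖_{L²_s} ≤ C · M^{−1/2} · ‖f‖_{L²_s} ‖g‖_{L²_s}.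 -/
open MeasureTheory

open scoped ENNReal

namespace Kaw

theorem cs (a b : ℝ → ℝ≥0∞) (ha : Measurable a) (hb : Measurable b) :
    (∫⁻ x, a x * b x) ^ 2 ≤ (∫⁻ x, a x ^ 2) * ∫⁻ x, b x ^ 2 := by
  have h := ENNReal.lintegral_mul_le_Lp_mul_Lq volume Real.HolderConjugate.two_two
    ha.aemeasurable hb.aemeasurable
  have h2 := pow_le_pow_left' h 2
  simp only [Pi.mul_apply] at h2
  refine h2.trans (le_of_eq ?_)
  rw [mul_pow]
  congr 1 <;>
  · rw [← ENNReal.rpow_natCast, ← ENNReal.rpow_mul]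
    norm_num

theorem lint_base (M D x0 : ℝ) (hM : 0 < M) (hD : 0 < D) :
    ∫⁻ x, ENNReal.ofReal (2 / M ^ 2 * (1 + ((x - x0) * (D / (3 * M))) ^ 2)⁻¹)
      = ENNReal.ofReal (6 * Real.pi / (M * D)) := by
  have hc : D / (3 * M) ≠ 0 := by positivity
  have hi : Integrable (fun x : ℝ => (1 + ((x - x0) * (D / (3 * M))) ^ 2)⁻¹) :=
    (integrable_inv_one_add_sq.comp_mul_right' hc).comp_sub_right x0
  rw [← ofReal_integral_eq_lintegral_ofReal (hi.const_mul _)]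
  · congr 1
    rw [integral_const_mul,
      integral_sub_right_eq_self (fun x : ℝ => (1 + (x * (D / (3 * M))) ^ 2)⁻¹) x0,
      Measure.integral_comp_mul_right (fun x : ℝ => (1 + x ^ 2)⁻¹), integral_univ_inv_one_add_sq,
      abs_of_pos (by positivity), smul_eq_mul]
    field_simp
    norm_num
  · filter_upwards with x
    positivity

theorem expansive (S : Set ℝ) (h : ℝ → ℝ) (D M : ℝ) (hD : 0 < D) (hM : 1 ≤ M)
    (hexp : ∀ x ∈ S, ∀ y ∈ S, D * |x - y| ≤ |h x - h y|) (k : ℝ → ℝ≥0∞)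
    (hk : ∀ x, k x ≠ 0 → x ∈ S ∧ M < |h x| ∧ k x ≤ ENNReal.ofReal (1 / (h x) ^ 2)) :
    ∫⁻ x, k x ≤ ENNReal.ofReal (6 * Real.pi / (M * D)) := by
  by_cases hS : S.Nonempty
  · have hne : ((fun x => |h x|) '' S).Nonempty := hS.image _
    have hbd : BddBelow ((fun x => |h x|) '' S) := ⟨0, by rintro _ ⟨x, -, rfl⟩; positivity⟩
    obtain ⟨_, ⟨x0, hx0, rfl⟩, hlt⟩ := Real.lt_sInf_add_pos hne one_pos
    rw [← lint_base M D x0 (by linarith) hD]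
    refine lintegral_mono fun x => ?_
    by_cases hkx : k x = 0
    · simp [hkx]
    obtain ⟨hxS, hMx, hle⟩ := hk x hkx
    refine hle.trans (ENNReal.ofReal_le_ofReal ?_)
    have h1 : |h x0| ≤ |h x| + 1 := by
      have := csInf_le hbd ⟨x, hxS, rfl⟩
      simp only at this hlt
      linarith
    have h2 := hexp x hxS x0 hx0
    have h3 : D * |x - x0| ≤ 3 * |h x| := by
      have := abs_sub (h x) (h x0)
      linarith
    have hM0 : 0 < M := by linarith
    have h4 : D ^ 2 * (x - x0) ^ 2 ≤ 9 * (h x) ^ 2 := by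
      have := pow_le_pow_left₀ (by positivity) h3 2
      rw [mul_pow, mul_pow, sq_abs, sq_abs] at this
      linarith
    have h5 : M ^ 2 ≤ (h x) ^ 2 := by
      have := pow_le_pow_left₀ hM0.le hMx.le 2
      rwa [sq_abs] at this
    have e : 2 / M ^ 2 * (1 + ((x - x0) * (D / (3 * M))) ^ 2)⁻¹
        = 2 / (M ^ 2 + D ^ 2 * (x - x0) ^ 2 / 9) := by
      field_simp
      ring
    rw [e, div_le_div_iff₀ (by nlinarith) (by positivity)]
    linarith
  · have : ∀ x, k x = 0 := fun x => by
      by_contra hh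
      exact hS ⟨x, (hk x hh).1⟩
    simp [this]

noncomputable def ker (β α M ξ x : ℝ) : ℝ≥0∞ :=
  if M < |Phi β ξ x (ξ - x) - α| then ENNReal.ofReal (|ξ| / |Phi β ξ x (ξ - x) - α|) else 0

def RC (K ξ x : ℝ) : Prop := 10 * K ≤ |ξ| ∧ |x - ξ / 2| < |ξ| / 10

open Classical in
noncomputable def kC (K β α M ξ x : ℝ) : ℝ≥0∞ := if RC K ξ x then ker β α M ξ x else 0

open Classical in
noncomputable def kD (K β α M ξ x : ℝ) : ℝ≥0∞ := if RC K ξ x then 0 else ker β α M ξ x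

theorem ker_add (K β α M ξ x : ℝ) : ker β α M ξ x = kC K β α M ξ x + kD K β α M ξ x := by
  unfold kC kD
  split_ifs <;> simp

theorem meas_ker (β α M : ℝ) : Measurable (fun p : ℝ × ℝ => ker β α M p.1 p.2) := by
  unfold ker Phi
  refine Measurable.ite ?_ ?_ measurable_const
  · exact measurableSet_lt measurable_const (by fun_prop)
  · fun_prop

theorem meas_ker1 (β α M ξ : ℝ) : Measurable (ker β α M ξ) := by
  unfold ker Phi
  refine Measurable.ite ?_ ?_ measurable_const
  · exact measurableSet_lt measurable_const (by fun_prop)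
  · fun_prop

theorem meas_RC (K : ℝ) : MeasurableSet {p : ℝ × ℝ | RC K p.1 p.2} := by
  unfold RC
  refine MeasurableSet.inter (s₁ := {p : ℝ × ℝ | 10 * K ≤ |p.1|})
    (s₂ := {p : ℝ × ℝ | |p.2 - p.1 / 2| < |p.1| / 10}) ?_ ?_
  · exact measurableSet_le measurable_const (by fun_prop)
  · exact measurableSet_lt (by fun_prop) (by fun_prop)

theorem meas_kC (K β α M : ℝ) : Measurable (fun p : ℝ × ℝ => kC K β α M p.1 p.2) := by
  unfold kC
  exact Measurable.ite (meas_RC K) (meas_ker β α M) measurable_const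

theorem meas_kD (K β α M : ℝ) : Measurable (fun p : ℝ × ℝ => kD K β α M p.1 p.2) := by
  unfold kD
  exact Measurable.ite (meas_RC K) measurable_const (meas_ker β α M)

theorem ker_sq {β α M ξ x : ℝ} (hM : 1 ≤ M) (h : ker β α M ξ x ≠ 0) :
    M < |Phi β ξ x (ξ - x) - α| ∧ ξ ≠ 0 ∧
    ker β α M ξ x ^ 2 = ENNReal.ofReal (ξ ^ 2) *
      ENNReal.ofReal (1 / (Phi β ξ x (ξ - x) - α) ^ 2) := by
  unfold ker at h ⊢
  split_ifs at h ⊢ with h1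
  · refine ⟨h1, ?_, ?_⟩
    · rintro rfl
      simp at h
    · rw [← ENNReal.ofReal_pow (by positivity), ← ENNReal.ofReal_mul (by positivity), div_pow,
        sq_abs, sq_abs]
      congr 1
      ring
  · exact absurd rfl h

theorem boundC (β α M x : ℝ) (hM : 1 ≤ M) :
    ∫⁻ ξ, kC (1 + |β|) β α M ξ x ^ 2 ≤ ENNReal.ofReal (38 * Real.pi / M) := by
  by_cases hx : x = 0
  · have : ∀ ξ, kC (1 + |β|) β α M ξ x = 0 := by
      intro ξ
      unfold kC
      rw [if_neg]
      rintro ⟨h1, h2⟩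
      rw [hx, zero_sub, abs_neg, abs_div] at h2
      norm_num at h2
      have := abs_nonneg β
      linarith
    simp [this]
  have hx2 : 0 < x ^ 2 := by positivity
  have key : ∫⁻ ξ, (ENNReal.ofReal (25 / 4 * x ^ 2))⁻¹ * kC (1 + |β|) β α M ξ x ^ 2
      ≤ ENNReal.ofReal (6 * Real.pi / (M * x ^ 2)) := by
    refine expansive {ξ | RC (1 + |β|) ξ x} (fun ξ => Phi β ξ x (ξ - x) - α) (x ^ 2) M
      hx2 hM ?_ _ ?_
    · rintro a ⟨ha1, ha2⟩ b ⟨hb1, hb2⟩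
      have hβ := abs_nonneg β
      have hβ1 := neg_abs_le β
      have e : (Phi β a x (a - x) - α) - (Phi β b x (b - x) - α)
          = -((a - b) * (x * (a + b - x) *
            (5 * (a * (a - x) + b * (b - x)) + 5 * x ^ 2 + 3 * β))) := by
        unfold Phi; ring
      rw [e, abs_neg, abs_mul, mul_comm (x ^ 2)]
      refine mul_le_mul_of_nonneg_left ?_ (abs_nonneg _)
      have main : ∀ a b : ℝ, |x - a / 2| < |a| / 10 → |x - b / 2| < |b| / 10 →
          10 * (1 + |β|) ≤ |a| → 10 * (1 + |β|) ≤ |b| →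
          x ^ 2 ≤ x * (a + b - x) ∧ 0 ≤ a * (a - x) ∧ 16 * (1 + |β|) ^ 2 ≤ x ^ 2 := by
        intro a b ha hb ha1 hb1
        rw [abs_lt] at ha hb
        rcases abs_cases a with ⟨h, _⟩ | ⟨h, _⟩ <;> rcases abs_cases b with ⟨h', _⟩ | ⟨h', _⟩ <;>
          rw [h] at ha ha1 <;> rw [h'] at hb hb1
        · exact ⟨by nlinarith, by nlinarith, by nlinarith⟩
        · exfalso; linarith
        · exfalso; linarith
        · exact ⟨by nlinarith, by nlinarith, by nlinarith⟩
      obtain ⟨m1, m2, m3⟩ := main a b ha2 hb2 ha1 hb1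
      obtain ⟨-, m4, -⟩ := main b a hb2 ha2 hb1 ha1
      have m5 : 1 ≤ 5 * (a * (a - x) + b * (b - x)) + 5 * x ^ 2 + 3 * β := by nlinarith
      refine le_trans ?_ (le_abs_self _)
      nlinarith
    · intro ξ hne
      have hk : kC (1 + |β|) β α M ξ x ≠ 0 := by
        intro h0; simp [h0] at hne
      have hR : RC (1 + |β|) ξ x := by
        by_contra hn; simp [kC, hn] at hk
      have hkk : kC (1 + |β|) β α M ξ x = ker β α M ξ x := by simp [kC, hR]
      rw [hkk] at hk ⊢
      obtain ⟨h1, h2, h3⟩ := ker_sq hM hk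
      refine ⟨hR, h1, ?_⟩
      rw [h3, ← mul_assoc]
      refine (mul_le_mul_left (b := (ENNReal.ofReal (25 / 4 * x ^ 2))⁻¹ * ENNReal.ofReal (ξ ^ 2))
        (c := 1) ?_ _).trans (by rw [one_mul])
      rw [mul_comm, ← div_eq_mul_inv]
      refine ENNReal.div_le_of_le_mul ?_
      rw [one_mul]
      apply ENNReal.ofReal_le_ofReal
      have := hR.2
      rw [abs_lt] at this
      rcases abs_cases ξ with ⟨h, _⟩ | ⟨h, _⟩ <;> rw [h] at this <;> nlinarith
  rw [lintegral_const_mul' _ _ (by simpa using hx2)] at key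
  have hp : 0 < 25 / 4 * x ^ 2 := by positivity
  rw [← ENNReal.div_eq_inv_mul, ENNReal.div_le_iff (by simpa using hx2) (by simp)] at key
  refine key.trans ?_
  rw [← ENNReal.ofReal_mul (by positivity)]
  apply ENNReal.ofReal_le_ofReal
  have : 6 * Real.pi / (M * x ^ 2) * (25 / 4 * x ^ 2) = 37.5 * Real.pi / M := by
    field_simp; norm_num
  rw [this]
  gcongr
  norm_num

theorem boundA (β α M ξ : ℝ) (hM : 1 ≤ M) (σ : ℝ) (hσ : σ = 1 ∨ σ = -1) (hξ : ξ ≠ 0)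
    (k : ℝ → ℝ≥0∞)
    (hk : ∀ x, k x ≠ 0 → k x = ker β α M ξ x ∧ 1 + |β| ≤ σ * (x - ξ / 2) ∧
      |ξ| / 10 ≤ σ * (x - ξ / 2)) :
    ∫⁻ x, k x ^ 2 ≤ ENNReal.ofReal (30 * Real.pi / M) := by
  have hx2 : 0 < ξ ^ 2 := by positivity
  have key : ∫⁻ x, (ENNReal.ofReal (ξ ^ 2))⁻¹ * k x ^ 2
      ≤ ENNReal.ofReal (6 * Real.pi / (M * (ξ ^ 2 / 5))) := by
    refine expansive {x | 1 + |β| ≤ σ * (x - ξ / 2) ∧ |ξ| / 10 ≤ σ * (x - ξ / 2)}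
      (fun x => Phi β ξ x (ξ - x) - α) (ξ ^ 2 / 5) M (by positivity) hM ?_ _ ?_
    · rintro a ⟨ha1, ha2⟩ b ⟨hb1, hb2⟩
      have hβ := abs_nonneg β
      have hβ1 := neg_abs_le β
      have e : (Phi β ξ a (ξ - a) - α) - (Phi β ξ b (ξ - b) - α)
          = (a - b) * (ξ * ((a - ξ / 2) + (b - ξ / 2)) *
            (5 * ((a - ξ / 2) ^ 2 + (b - ξ / 2) ^ 2) + 5 / 2 * ξ ^ 2 + 3 * β)) := by
        unfold Phi; ring
      rw [e, abs_mul, mul_comm (ξ ^ 2 / 5)]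
      refine mul_le_mul_of_nonneg_left ?_ (abs_nonneg _)
      generalize a - ξ / 2 = y at *
      generalize b - ξ / 2 = z at *
      have hs : σ ^ 2 = 1 := by rcases hσ with rfl | rfl <;> norm_num
      have hy : (1 + |β|) ^ 2 ≤ y ^ 2 := by
        have := pow_le_pow_left₀ (by positivity) ha1 2
        rwa [mul_pow, hs, one_mul] at this
      have m5 : 1 ≤ 5 * (y ^ 2 + z ^ 2) + 5 / 2 * ξ ^ 2 + 3 * β := by nlinarith [sq_nonneg z]
      have m6 : |ξ| / 5 ≤ |y + z| := by
        have h1 : |σ * (y + z)| = |y + z| := by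
          rcases hσ with rfl | rfl <;> rw [abs_mul] <;> simp
        rw [← h1]
        refine le_trans ?_ (le_abs_self _)
        linarith
      rw [abs_mul, abs_mul]
      have m7 : 1 ≤ |5 * (y ^ 2 + z ^ 2) + 5 / 2 * ξ ^ 2 + 3 * β| := m5.trans (le_abs_self _)
      have m8 : ξ ^ 2 / 5 ≤ |ξ| * |y + z| := by
        rw [← sq_abs]
        nlinarith [abs_nonneg ξ]
      nlinarith
    · intro x hne
      have hk0 : k x ≠ 0 := by
        intro h0; simp [h0] at hne
      obtain ⟨hkk, hR⟩ := hk x hk0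
      rw [hkk] at hk0 ⊢
      obtain ⟨h1, h2, h3⟩ := ker_sq hM hk0
      refine ⟨hR, h1, ?_⟩
      rw [h3, ← mul_assoc, ENNReal.inv_mul_cancel (by simpa using hξ) (by simp), one_mul]
  rw [lintegral_const_mul' _ _ (by simpa using hξ)] at key
  rw [← ENNReal.div_eq_inv_mul, ENNReal.div_le_iff (by simpa using hξ) (by simp)] at key
  refine key.trans ?_
  rw [← ENNReal.ofReal_mul (by positivity)]
  apply ENNReal.ofReal_le_ofReal
  have : 6 * Real.pi / (M * (ξ ^ 2 / 5)) * (ξ ^ 2) = 30 * Real.pi / M := by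
    field_simp; norm_num
  rw [this]

theorem boundB (β α M ξ : ℝ) (hM : 1 ≤ M) (K : ℝ) (hK : 0 < K) (k : ℝ → ℝ≥0∞)
    (hk : ∀ x, k x ≠ 0 → k x = ker β α M ξ x ∧ |ξ| ≤ 10 * K ∧ |x - ξ / 2| ≤ K) :
    ∫⁻ x, k x ^ 2 ≤ ENNReal.ofReal (200 * K ^ 3 / M) := by
  have : ∀ x, k x ^ 2 ≤ (Set.Icc (ξ / 2 - K) (ξ / 2 + K)).indicator
      (fun _ => ENNReal.ofReal (100 * K ^ 2 / M)) x := by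
    intro x
    by_cases h0 : k x = 0
    · simp [h0]
    obtain ⟨h1, h2, h3⟩ := hk x h0
    rw [abs_le] at h3
    rw [Set.indicator_of_mem (by constructor <;> linarith)]
    rw [h1] at h0 ⊢
    obtain ⟨g1, g2, g3⟩ := ker_sq hM h0
    rw [g3, ← ENNReal.ofReal_mul (by positivity)]
    apply ENNReal.ofReal_le_ofReal
    rw [mul_one_div]
    have a1 : ξ ^ 2 ≤ 100 * K ^ 2 := by
      have := pow_le_pow_left₀ (abs_nonneg _) h2 2
      rw [sq_abs] at this
      linarith
    have a2 : M ≤ (Phi β ξ x (ξ - x) - α) ^ 2 := by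
      rw [← sq_abs]; nlinarith
    gcongr
  refine (lintegral_mono this).trans ?_
  rw [lintegral_indicator measurableSet_Icc, setLIntegral_const, Real.volume_Icc,
    ← ENNReal.ofReal_mul (by positivity)]
  apply ENNReal.ofReal_le_ofReal
  apply le_of_eq
  field_simp
  ring

theorem c3lem (b X y : ℝ) (hb : 0 ≤ b) (hX : 0 ≤ X)
    (c1 : ¬ (1 + b ≤ 1 * y ∧ X / 10 ≤ 1 * y)) (c2 : ¬ (1 + b ≤ -1 * y ∧ X / 10 ≤ -1 * y))
    (hR : ¬ (10 * (1 + b) ≤ X ∧ |y| < X / 10)) : X ≤ 10 * (1 + b) ∧ |y| ≤ 1 + b := by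
  simp only [not_and_or, not_le, not_lt] at c1 c2 hR
  rcases abs_cases y with ⟨h, _⟩ | ⟨h, _⟩ <;> rw [h] at hR ⊢ <;>
    rcases c1 with c1 | c1 <;> rcases c2 with c2 | c2 <;> rcases hR with hR | hR <;>
    constructor <;> linarith

noncomputable def C0 (β : ℝ) : ℝ := 98 * Real.pi + 200 * (1 + |β|) ^ 3

open Classical in
noncomputable def cut (P : ℝ → Prop) (k : ℝ → ℝ≥0∞) (x : ℝ) : ℝ≥0∞ := if P x then k x else 0

theorem cut_pos {P : ℝ → Prop} {k : ℝ → ℝ≥0∞} {x : ℝ} (h : P x) : cut P k x = k x := if_pos h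

theorem cut_ne {P : ℝ → Prop} {k : ℝ → ℝ≥0∞} {x : ℝ} (h : cut P k x ≠ 0) :
    cut P k x = k x ∧ P x := by
  by_cases hP : P x
  · exact ⟨cut_pos hP, hP⟩
  · exact absurd (if_neg hP) h

theorem meas_cut {P : ℝ → Prop} {k : ℝ → ℝ≥0∞} (hP : MeasurableSet {x | P x})
    (hk : Measurable k) : Measurable (cut P k) :=
  Measurable.ite hP hk measurable_const

def PA (β ξ σ x : ℝ) : Prop := 1 + |β| ≤ σ * (x - ξ / 2) ∧ |ξ| / 10 ≤ σ * (x - ξ / 2)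

def PB (β ξ x : ℝ) : Prop := |ξ| ≤ 10 * (1 + |β|) ∧ |x - ξ / 2| ≤ 1 + |β|

theorem meas_PA (β ξ σ : ℝ) : MeasurableSet {x | PA β ξ σ x} := by
  refine MeasurableSet.inter (s₁ := {x : ℝ | 1 + |β| ≤ σ * (x - ξ / 2)})
    (s₂ := {x : ℝ | |ξ| / 10 ≤ σ * (x - ξ / 2)}) ?_ ?_
  · exact measurableSet_le measurable_const (by fun_prop)
  · exact measurableSet_le measurable_const (by fun_prop)

theorem kD_le (β α M ξ x : ℝ) : kD (1 + |β|) β α M ξ x ^ 2 ≤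
    cut (PA β ξ 1) (ker β α M ξ) x ^ 2 + (cut (PA β ξ (-1)) (ker β α M ξ) x ^ 2
      + cut (PB β ξ) (ker β α M ξ) x ^ 2) := by
  by_cases hR : RC (1 + |β|) ξ x
  · simp [kD, hR]
  have e : kD (1 + |β|) β α M ξ x = ker β α M ξ x := by simp [kD, hR]
  rw [e]
  by_cases c1 : PA β ξ 1 x
  · rw [cut_pos c1]; exact le_self_add
  by_cases c2 : PA β ξ (-1) x
  · rw [cut_pos c2]; exact le_add_left le_self_add
  have c3 : PB β ξ x :=
    c3lem (|β|) |ξ| (x - ξ / 2) (abs_nonneg _) (abs_nonneg _) c1 c2 hR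
  rw [cut_pos c3]; exact le_add_left (le_add_left le_rfl)

theorem C0tail (β M : ℝ) (hM0 : 0 < M) :
    ENNReal.ofReal (30 * Real.pi / M) + (ENNReal.ofReal (30 * Real.pi / M) +
      ENNReal.ofReal (200 * (1 + |β|) ^ 3 / M)) ≤ ENNReal.ofReal (C0 β / M) := by
  have hpi := Real.pi_pos
  have h1 : 0 ≤ 30 * Real.pi / M := by positivity
  have h2 : 0 ≤ 200 * (1 + |β|) ^ 3 / M := by positivity
  rw [← ENNReal.ofReal_add h1 h2, ← ENNReal.ofReal_add h1 (add_nonneg h1 h2)]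
  apply ENNReal.ofReal_le_ofReal
  have h3 : C0 β / M = 30 * Real.pi / M + (30 * Real.pi / M + 200 * (1 + |β|) ^ 3 / M)
      + 38 * Real.pi / M := by
    unfold C0; ring
  have h4 : 0 ≤ 38 * Real.pi / M := by positivity
  rw [h3]
  exact le_add_of_nonneg_right h4

theorem boundD (β α M ξ : ℝ) (hM : 1 ≤ M) :
    ∫⁻ x, kD (1 + |β|) β α M ξ x ^ 2 ≤ ENNReal.ofReal (C0 β / M) := by
  have hM0 : 0 < M := by linarith
  by_cases hξ : ξ = 0
  · have h0 : ∀ x, kD (1 + |β|) β α M ξ x ^ 2 = 0 := by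
      intro x
      by_contra hne
      have hk : kD (1 + |β|) β α M ξ x ≠ 0 := fun h => hne (by rw [h]; norm_num)
      have hk2 : ker β α M ξ x ≠ 0 := fun h => hk (by unfold kD; rw [h, ite_self])
      exact (ker_sq hM hk2).2.1 hξ
    rw [lintegral_congr h0, lintegral_zero]
    exact zero_le
  have hmk : Measurable (ker β α M ξ) := meas_ker1 β α M ξ
  have hm1 := meas_cut (meas_PA β ξ 1) hmk
  have hm2 := meas_cut (meas_PA β ξ (-1)) hmk
  have b1 := boundA β α M ξ hM 1 (Or.inl rfl) hξ (cut (PA β ξ 1) (ker β α M ξ))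
    fun x hx => cut_ne hx
  have b2 := boundA β α M ξ hM (-1) (Or.inr rfl) hξ (cut (PA β ξ (-1)) (ker β α M ξ))
    fun x hx => cut_ne hx
  have b3 := boundB β α M ξ hM (1 + |β|) (by positivity) (cut (PB β ξ) (ker β α M ξ))
    fun x hx => cut_ne hx
  have hle := kD_le β α M ξ
  have ht : ENNReal.ofReal (30 * Real.pi / M) + (ENNReal.ofReal (30 * Real.pi / M) +
      ENNReal.ofReal (200 * (1 + |β|) ^ 3 / M)) ≤ ENNReal.ofReal (C0 β / M) :=
    C0tail β M hM0
  refine (lintegral_mono hle).trans ?_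
  rw [lintegral_add_left (hm1.pow_const 2), lintegral_add_left (hm2.pow_const 2)]
  exact (add_le_add b1 (add_le_add b2 b3)).trans ht

theorem add_sq_le' (a b : ℝ≥0∞) : (a + b) ^ 2 ≤ 2 * (a ^ 2 + b ^ 2) := by
  have h := ENNReal.rpow_add_le_mul_rpow_add_rpow a b (p := 2) (by norm_num)
  norm_num at h
  exact_mod_cast h

theorem L2bound (β α M : ℝ) (hM : 1 ≤ M) (f g : ℝ → ℝ≥0∞) (hf : Measurable f)
    (hg : Measurable g) :
    ∫⁻ ξ, (∫⁻ x, ker β α M ξ x * (f x * g (ξ - x))) ^ 2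
      ≤ ENNReal.ofReal (4 * C0 β / M) * ((∫⁻ x, f x ^ 2) * ∫⁻ x, g x ^ 2) := by
  have hM0 : 0 < M := by linarith
  set K := 1 + |β|
  have hC := meas_kC K β α M
  have hD := meas_kD K β α M
  have hCl : ∀ ξ, Measurable (fun x => kC K β α M ξ x) :=
    fun ξ => hC.comp measurable_prodMk_left
  have hDl : ∀ ξ, Measurable (fun x => kD K β α M ξ x) :=
    fun ξ => hD.comp measurable_prodMk_left
  have hgs : ∀ ξ, Measurable (fun x => g (ξ - x)) := fun ξ => hg.comp (by fun_prop)
  have hgs2 : Measurable (fun p : ℝ × ℝ => g (p.1 - p.2)) := hg.comp (by fun_prop)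
  have hf2 : Measurable (fun p : ℝ × ℝ => f p.2) := hf.comp measurable_snd
  have hpt : ∀ ξ, (∫⁻ x, ker β α M ξ x * (f x * g (ξ - x))) ^ 2 ≤
      2 * ((∫⁻ x, (kC K β α M ξ x * f x) ^ 2) * (∫⁻ x, g x ^ 2)
        + ENNReal.ofReal (C0 β / M) * ∫⁻ x, f x ^ 2 * g (ξ - x) ^ 2) := by
    intro ξ
    have e : ∫⁻ x, ker β α M ξ x * (f x * g (ξ - x)) =
        (∫⁻ x, (kC K β α M ξ x * f x) * g (ξ - x)) +
          ∫⁻ x, kD K β α M ξ x * (f x * g (ξ - x)) := by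
      have hm : Measurable (fun x => (kC K β α M ξ x * f x) * g (ξ - x)) :=
        ((hCl ξ).mul hf).mul (hgs ξ)
      rw [← lintegral_add_left hm]
      refine lintegral_congr fun x => ?_
      rw [ker_add K]; ring
    rw [e]
    refine (add_sq_le' _ _).trans ?_
    gcongr
    · refine (cs _ _ ((hCl ξ).mul hf) (hgs ξ)).trans (le_of_eq ?_)
      congr 1
      exact lintegral_sub_left_eq_self (fun x => g x ^ 2) ξ
    · refine (cs _ _ (hDl ξ) (hf.mul (hgs ξ))).trans ?_
      simp only [Pi.mul_apply, mul_pow]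
      gcongr
      exact boundD β α M ξ hM
  refine (lintegral_mono hpt).trans ?_
  have mA : Measurable (fun p : ℝ × ℝ => (kC K β α M p.1 p.2 * f p.2) ^ 2) :=
    (hC.mul hf2).pow_const 2
  have mB : Measurable (fun p : ℝ × ℝ => f p.2 ^ 2 * g (p.1 - p.2) ^ 2) :=
    (hf2.pow_const 2).mul (hgs2.pow_const 2)
  have mA' : Measurable (fun ξ => ∫⁻ x, (kC K β α M ξ x * f x) ^ 2) := mA.lintegral_prod_right'
  have mB' : Measurable (fun ξ => ∫⁻ x, f x ^ 2 * g (ξ - x) ^ 2) := mB.lintegral_prod_right'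
  have sA : ∫⁻ ξ, ∫⁻ x, (kC K β α M ξ x * f x) ^ 2 = ∫⁻ x, ∫⁻ ξ, (kC K β α M ξ x * f x) ^ 2 :=
    lintegral_lintegral_swap mA.aemeasurable
  have sB : ∫⁻ ξ, ∫⁻ x, f x ^ 2 * g (ξ - x) ^ 2 = ∫⁻ x, ∫⁻ ξ, f x ^ 2 * g (ξ - x) ^ 2 :=
    lintegral_lintegral_swap mB.aemeasurable
  rw [lintegral_const_mul' _ _ (by simp), lintegral_add_left (mA'.mul_const _),
    lintegral_mul_const _ mA', lintegral_const_mul _ mB', sA, sB]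
  have i1 : ∫⁻ x, ∫⁻ ξ, (kC K β α M ξ x * f x) ^ 2
      ≤ ENNReal.ofReal (C0 β / M) * ∫⁻ x, f x ^ 2 := by
    rw [← lintegral_const_mul _ (hf.pow_const 2)]
    refine lintegral_mono fun x => ?_
    simp only [mul_pow]
    have hCr : Measurable (fun ξ => kC K β α M ξ x) := hC.comp measurable_prodMk_right
    rw [lintegral_mul_const _ (hCr.pow_const 2)]
    gcongr
    refine (boundC β α M x hM).trans (ENNReal.ofReal_le_ofReal ?_)
    unfold C0
    have := Real.pi_pos
    have : 0 ≤ (1 + |β|) ^ 3 := by positivity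
    gcongr
    linarith
  have i2 : ∫⁻ x, ∫⁻ ξ, f x ^ 2 * g (ξ - x) ^ 2 = (∫⁻ x, f x ^ 2) * ∫⁻ x, g x ^ 2 := by
    rw [← lintegral_mul_const _ (hf.pow_const 2)]
    refine lintegral_congr fun x => ?_
    have : Measurable (fun ξ => g (ξ - x) ^ 2) := (hg.comp (by fun_prop)).pow_const 2
    rw [lintegral_const_mul _ this, lintegral_sub_right_eq_self (fun x => g x ^ 2) x]
  rw [i2]
  have e4 : ENNReal.ofReal (4 * C0 β / M) = 4 * ENNReal.ofReal (C0 β / M) := by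
    rw [mul_div_assoc, ENNReal.ofReal_mul (by norm_num)]
    norm_num
  rw [e4]
  calc _ ≤ 2 * ((ENNReal.ofReal (C0 β / M) * ∫⁻ x, f x ^ 2) * (∫⁻ x, g x ^ 2)
        + ENNReal.ofReal (C0 β / M) * ((∫⁻ x, f x ^ 2) * ∫⁻ x, g x ^ 2)) := by gcongr
    _ = _ := by ring

/-- weighted modulus -/
noncomputable def wt (s : ℝ) (f : ℝ → ℂ) (x : ℝ) : ℝ≥0∞ :=
  ENNReal.ofReal ((1 + x ^ 2) ^ (s / 2)) * ‖f x‖ₑ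

theorem wt_sq (s : ℝ) (f : ℝ → ℂ) (x : ℝ) :
    wt s f x ^ 2 = ENNReal.ofReal ((1 + x ^ 2) ^ s * ‖f x‖ ^ 2) := by
  unfold wt
  have h : 0 < 1 + x ^ 2 := by positivity
  rw [← ofReal_norm, ← ENNReal.ofReal_mul (by positivity),
    ← ENNReal.ofReal_pow (by positivity), mul_pow, ← Real.rpow_natCast, ← Real.rpow_mul h.le]
  norm_num

theorem meas_wt (s : ℝ) (f : ℝ → ℂ) (hf : Measurable f) : Measurable (wt s f) := by
  unfold wt
  exact (by fun_prop : Measurable fun x : ℝ => ENNReal.ofReal ((1 + x ^ 2) ^ (s / 2))).mul hf.enorm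

theorem lint_wt (s : ℝ) (f : ℝ → ℂ)
    (hi : Integrable (fun ξ : ℝ => (1 + ξ ^ 2) ^ s * ‖f ξ‖ ^ 2)) :
    ∫⁻ x, wt s f x ^ 2 = ENNReal.ofReal (∫ ξ : ℝ, (1 + ξ ^ 2) ^ s * ‖f ξ‖ ^ 2) := by
  simp only [wt_sq]
  rw [ofReal_integral_eq_lintegral_ofReal hi]
  filter_upwards with x
  positivity

theorem weight (s : ℝ) (hs : 0 ≤ s) (ξ x : ℝ) :
    ENNReal.ofReal ((1 + ξ ^ 2) ^ (s / 2)) ≤ ENNReal.ofReal (2 ^ (s / 2)) *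
      (ENNReal.ofReal ((1 + x ^ 2) ^ (s / 2)) * ENNReal.ofReal ((1 + (ξ - x) ^ 2) ^ (s / 2))) := by
  rw [← ENNReal.ofReal_mul (by positivity), ← ENNReal.ofReal_mul (by positivity),
    ← Real.mul_rpow (by positivity) (by positivity),
    ← Real.mul_rpow (by positivity) (by positivity)]
  apply ENNReal.ofReal_le_ofReal
  refine Real.rpow_le_rpow (by positivity) ?_ (by positivity)
  nlinarith [sq_nonneg (x - (ξ - x)), sq_nonneg (x * (ξ - x))]

end Kaw

open Kaw in
/-- Estimate (im) of Proposition 3.1: `‖I^α_{>M}(f,g)‖_{H^s} ≲ M^{−1/2} ‖f‖_{H^s} ‖g‖_{H^s}`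
for `s ≥ 0` (stated on the Fourier side). -/
theorem kawahara_I_gtM_estimate (s β : ℝ) (hs : 0 ≤ s) :
    ∃ C > 0, ∀ (t α M : ℝ), 1 ≤ M → ∀ f g : ℝ → ℂ,
      Measurable f → Measurable g →
      Integrable (fun ξ : ℝ => (1 + ξ ^ 2) ^ s * ‖f ξ‖ ^ 2) →
      Integrable (fun ξ : ℝ => (1 + ξ ^ 2) ^ s * ‖g ξ‖ ^ 2) →
      wnorm s (fun ξ : ℝ => ∫ ξ₁ : ℝ,
          if M < |Phi β ξ ξ₁ (ξ - ξ₁) - α| then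
            Complex.I * (ξ : ℂ)
              * (Complex.exp (Complex.I * (t : ℂ) * ((Phi β ξ ξ₁ (ξ - ξ₁) : ℝ) : ℂ))
                  / ((Phi β ξ ξ₁ (ξ - ξ₁) - α : ℝ) : ℂ))
              * f ξ₁ * g (ξ - ξ₁)
          else 0)
        ≤ C * M ^ (-(1 : ℝ) / 2) * wnorm s f * wnorm s g := by
  have hC0 : 0 < C0 β := by
    unfold C0
    have := Real.pi_pos
    positivity
  refine ⟨(2 ^ s * (4 * C0 β)) ^ ((1 : ℝ) / 2), by positivity, ?_⟩
  intro t α M hM f g hf hg hfi hgi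
  have hM0 : 0 < M := by linarith
  set F : ℝ → ℂ := fun ξ : ℝ => ∫ ξ₁ : ℝ,
          if M < |Phi β ξ ξ₁ (ξ - ξ₁) - α| then
            Complex.I * (ξ : ℂ)
              * (Complex.exp (Complex.I * (t : ℂ) * ((Phi β ξ ξ₁ (ξ - ξ₁) : ℝ) : ℂ))
                  / ((Phi β ξ ξ₁ (ξ - ξ₁) - α : ℝ) : ℂ))
              * f ξ₁ * g (ξ - ξ₁)
          else 0 with hF
  have hFpt : ∀ ξ, wt s F ξ ≤ ENNReal.ofReal (2 ^ (s / 2)) *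
      ∫⁻ x, ker β α M ξ x * (wt s f x * wt s g (ξ - x)) := by
    intro ξ
    have h1 : ‖F ξ‖ₑ ≤ ∫⁻ x, ker β α M ξ x * (‖f x‖ₑ * ‖g (ξ - x)‖ₑ) := by
      refine (enorm_integral_le_lintegral_enorm _).trans (le_of_eq (lintegral_congr fun x => ?_))
      unfold ker
      split_ifs with h
      · have he : ‖Complex.exp (Complex.I * (t : ℂ) * ((Phi β ξ x (ξ - x) : ℝ) : ℂ))‖ = 1 := by
          rw [mul_assoc, ← Complex.ofReal_mul, mul_comm]
          exact Complex.norm_exp_ofReal_mul_I _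
        have he2 : ‖Complex.I * (ξ : ℂ)
              * (Complex.exp (Complex.I * (t : ℂ) * ((Phi β ξ x (ξ - x) : ℝ) : ℂ))
                  / ((Phi β ξ x (ξ - x) - α : ℝ) : ℂ))‖
            = |ξ| / |Phi β ξ x (ξ - x) - α| := by
          rw [norm_mul, norm_mul, norm_div, he, Complex.norm_I, Complex.norm_real,
            Complex.norm_real, Real.norm_eq_abs, Real.norm_eq_abs]
          ring
        rw [enorm_mul, enorm_mul, ← ofReal_norm, he2, mul_assoc]
      · simp
    unfold wt
    refine (mul_le_mul_right h1 _).trans ?_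
    rw [← lintegral_const_mul' _ _ (by simp), ← lintegral_const_mul' _ _ (by simp)]
    refine lintegral_mono fun x => ?_
    refine (mul_le_mul_left (weight s hs ξ x) _).trans (le_of_eq ?_)
    ring
  have hmain : ∫⁻ ξ, wt s F ξ ^ 2 ≤ ENNReal.ofReal (2 ^ s * (4 * C0 β / M) *
      ((∫ ξ : ℝ, (1 + ξ ^ 2) ^ s * ‖f ξ‖ ^ 2) * ∫ ξ : ℝ, (1 + ξ ^ 2) ^ s * ‖g ξ‖ ^ 2)) := by
    have e2 : ENNReal.ofReal (2 ^ (s / 2)) ^ 2 = ENNReal.ofReal (2 ^ s) := by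
      rw [← ENNReal.ofReal_pow (by positivity), ← Real.rpow_natCast,
        ← Real.rpow_mul (by norm_num)]
      norm_num
    have nf : 0 ≤ ∫ ξ : ℝ, (1 + ξ ^ 2) ^ s * ‖f ξ‖ ^ 2 := integral_nonneg fun x => by positivity
    rw [ENNReal.ofReal_mul (by positivity), ENNReal.ofReal_mul (by positivity),
      ENNReal.ofReal_mul nf, ← lint_wt s f hfi, ← lint_wt s g hgi, mul_assoc]
    refine le_trans ?_ (mul_le_mul_right
      (L2bound β α M hM _ _ (meas_wt s f hf) (meas_wt s g hg)) _)
    rw [← lintegral_const_mul' _ _ (by simp)]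
    refine lintegral_mono fun ξ => ?_
    rw [← e2, ← mul_pow]
    exact pow_le_pow_left' (hFpt ξ) 2
  have nf : 0 ≤ ∫ ξ : ℝ, (1 + ξ ^ 2) ^ s * ‖f ξ‖ ^ 2 := integral_nonneg fun x => by positivity
  have ng : 0 ≤ ∫ ξ : ℝ, (1 + ξ ^ 2) ^ s * ‖g ξ‖ ^ 2 := integral_nonneg fun x => by positivity
  have hreal : ∫ ξ : ℝ, (1 + ξ ^ 2) ^ s * ‖F ξ‖ ^ 2 ≤ 2 ^ s * (4 * C0 β / M) *
      ((∫ ξ : ℝ, (1 + ξ ^ 2) ^ s * ‖f ξ‖ ^ 2) * ∫ ξ : ℝ, (1 + ξ ^ 2) ^ s * ‖g ξ‖ ^ 2) := by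
    have h1 := norm_integral_le_lintegral_norm (μ := volume)
      (fun ξ : ℝ => (1 + ξ ^ 2) ^ s * ‖F ξ‖ ^ 2)
    have h2 : ∫⁻ ξ : ℝ, ENNReal.ofReal ‖(1 + ξ ^ 2) ^ s * ‖F ξ‖ ^ 2‖ = ∫⁻ ξ, wt s F ξ ^ 2 := by
      refine lintegral_congr fun x => ?_
      rw [wt_sq, Real.norm_of_nonneg (by positivity)]
    rw [h2] at h1
    refine (le_abs_self _).trans (h1.trans ?_)
    exact ENNReal.toReal_le_of_le_ofReal (by positivity) hmain
  unfold wnorm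
  refine (Real.rpow_le_rpow (integral_nonneg fun x => by positivity) hreal (by norm_num)).trans
    (le_of_eq ?_)
  have e1 : 2 ^ s * (4 * C0 β / M) = (2 ^ s * (4 * C0 β)) * M⁻¹ := by ring
  have e3 : M ^ (-(1 : ℝ) / 2) = M⁻¹ ^ ((1 : ℝ) / 2) := by
    rw [Real.inv_rpow hM0.le, ← Real.rpow_neg hM0.le]
    norm_num
  rw [e1, e3, Real.mul_rpow (by positivity) (by positivity),
    Real.mul_rpow (by positivity) (by positivity), Real.mul_rpow nf ng]
  ring
end

section
/- Let s ≥ 0 and β ∈ ℝ. There exists C > 0 (depending only on s and β) such that for all t, α ∈ ℝ, all M ≥ 1, and all measurable f, g : ℝ → ℂ with ‖f‖_{L²_s}, ‖g‖_{L²_s} < ∞, writing I[h₁, h₂](ξ) = ∫_ℝ 1{|Φ_β(ξ, ξ₁, ξ − ξ₁) − α| > M} · (iξ) · exp(i t Φ_β(ξ, ξ₁, ξ − ξ₁)) / (Φ_β(ξ, ξ₁, ξ − ξ₁) − α) · h₁(ξ₁) · h₂(ξ − ξ₁) dξ₁, one has ‖I[f, f] − I[g, g]‖_{L²_s} ≤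 C · M^{−1/2} · ‖f − g‖_{L²_s} · (‖f‖_{L²_s} + ‖g‖_{L²_s}). -/
open MeasureTheory

/-- The bilinear operator `I^α_{>M}` (on the Fourier side). -/
noncomputable def Iop (β t α M : ℝ) (h₁ h₂ : ℝ → ℂ) (ξ : ℝ) : ℂ :=
  ∫ ξ₁ : ℝ,
    if M < |Phi β ξ ξ₁ (ξ - ξ₁) - α| then
      Complex.I * (ξ : ℂ)
        * (Complex.exp (Complex.I * (t : ℂ) * ((Phi β ξ ξ₁ (ξ - ξ₁) : ℝ) : ℂ))
            / ((Phi β ξ ξ₁ (ξ - ξ₁) - α : ℝ) : ℂ))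
        * h₁ ξ₁ * h₂ (ξ - ξ₁)
    else 0


/-- The truncated kernel `1{|u| > M} / u²`. -/
noncomputable def kq (M u : ℝ) : ENNReal := if M < |u| then ENNReal.ofReal (1 / u ^ 2) else 0

lemma kq_meas (M : ℝ) : Measurable (kq M) := by
  unfold kq
  refine Measurable.ite ?_ (by fun_prop) measurable_const
  exact measurableSet_lt measurable_const (by fun_prop)

lemma kq_le {M : ℝ} (hM : 1 ≤ M) (u : ℝ) : kq M u ≤ ENNReal.ofReal (1 / M) := by
  unfold kq
  split_ifs with h
  · apply ENNReal.ofReal_le_ofReal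
    rw [← sq_abs u]
    apply one_div_le_one_div_of_le (by linarith)
    nlinarith
  · exact zero_le

lemma lint_Ioi {M : ℝ} (hM : 1 ≤ M) :
    ∫⁻ u in Set.Ioi M, ENNReal.ofReal (1 / u ^ 2) = ENNReal.ofReal (1 / M) := by
  have h1 := integrableOn_Ioi_rpow_of_lt (a := -2) (c := M) (by norm_num) (by linarith)
  have h2 := integral_Ioi_rpow_of_lt (a := -2) (by norm_num) (c := M) (by linarith)
  have h3 := ofReal_integral_eq_lintegral_ofReal h1 (by
    refine (ae_restrict_mem measurableSet_Ioi).mono ?_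
    intro x hx
    have : 0 < x := by have := Set.mem_Ioi.1 hx; linarith
    exact Real.rpow_nonneg this.le _)
  rw [h2] at h3
  have h4 : -M ^ ((-2 : ℝ) + 1) / (-2 + 1) = 1 / M := by
    rw [show (-2 : ℝ) + 1 = -1 by norm_num, Real.rpow_neg_one]; ring
  rw [h4] at h3
  rw [h3]
  refine setLIntegral_congr_fun measurableSet_Ioi ?_
  intro x hx
  have : 0 < x := by have := Set.mem_Ioi.1 hx; linarith
  simp only
  rw [Real.rpow_neg this.le]
  norm_num

lemma lint_kq {M : ℝ} (hM : 1 ≤ M) (α : ℝ) :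
    ∫⁻ u, kq M (u - α) ≤ ENNReal.ofReal (2 / M) := by
  rw [lintegral_sub_right_eq_self (kq M) α]
  have hb : ∀ u, kq M u ≤ (Set.Ioi M).indicator (fun u => ENNReal.ofReal (1 / u ^ 2)) u
      + (Set.Ioi M).indicator (fun u => ENNReal.ofReal (1 / u ^ 2)) (-u) := by
    intro u
    unfold kq
    split_ifs with h
    · rcases lt_abs.1 h with h | h
      · rw [Set.indicator_of_mem (Set.mem_Ioi.2 h)]; exact le_self_add
      · rw [Set.indicator_of_mem (a := -u) (Set.mem_Ioi.2 h), neg_sq]; exact le_add_self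
    · exact zero_le
  have hm : Measurable ((Set.Ioi M).indicator (fun u : ℝ => ENNReal.ofReal (1 / u ^ 2))) :=
    Measurable.indicator (by fun_prop) measurableSet_Ioi
  calc ∫⁻ u, kq M u ≤ _ := lintegral_mono hb
    _ = _ := lintegral_add_left hm _
    _ = ENNReal.ofReal (1 / M) + ENNReal.ofReal (1 / M) := by
      rw [lintegral_neg_eq_self ((Set.Ioi M).indicator (fun u : ℝ => ENNReal.ofReal (1 / u ^ 2))),
        lintegral_indicator measurableSet_Ioi, lint_Ioi hM]
    _ ≤ _ := by
      rw [← ENNReal.ofReal_add (by positivity) (by positivity)]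
      apply ENNReal.ofReal_le_ofReal
      apply le_of_eq; ring

/-- One-dimensional change of variables bound. -/
lemma one_dim {M : ℝ} (hM : 1 ≤ M) (α c : ℝ) (hc : 0 ≤ c) (S : Set ℝ) (hS : S.OrdConnected)
    (φ φ' w : ℝ → ℝ) (hd : ∀ x, HasDerivAt φ (φ' x) x) (hw : ∀ x ∈ S, 0 < w x)
    (hle : ∀ x ∈ S, w x ≤ c * |φ' x|) :
    ∫⁻ x in S, ENNReal.ofReal (w x) * kq M (φ x - α) ≤ ENNReal.ofReal (c * (2 / M)) := by
  have hinj : Set.InjOn φ S := by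
    have key : ∀ a ∈ S, ∀ b ∈ S, a < b → φ a ≠ φ b := by
      intro a ha b hb hab he
      obtain ⟨x, hx, hx0⟩ := exists_hasDerivAt_eq_zero hab
        (fun x _ => (hd x).continuousAt.continuousWithinAt) he (fun x _ => hd x)
      have hxS := hS.out ha hb (Set.Ioo_subset_Icc_self hx)
      have h1 := hw x hxS
      have h2 := hle x hxS
      rw [hx0] at h2
      simp at h2
      linarith
    intro a ha b hb he
    rcases lt_trichotomy a b with h | h | h
    · exact absurd he (key a ha b hb h)
    · exact h
    · exact absurd he.symm (key b hb a ha h)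
  have hSm := hS.measurableSet
  have hcv := lintegral_image_eq_lintegral_abs_deriv_mul hSm
    (fun x _ => (hd x).hasDerivWithinAt) hinj (fun u => kq M (u - α))
  calc ∫⁻ x in S, ENNReal.ofReal (w x) * kq M (φ x - α)
      ≤ ∫⁻ x in S, ENNReal.ofReal c * (ENNReal.ofReal |φ' x| * kq M (φ x - α)) := by
        refine setLIntegral_mono' hSm ?_
        intro x hx
        rw [← mul_assoc, ← ENNReal.ofReal_mul hc]
        gcongr
        exact hle x hx
    _ = ENNReal.ofReal c * ∫⁻ x in S, (ENNReal.ofReal |φ' x| * kq M (φ x - α)) :=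
        lintegral_const_mul' _ _ ENNReal.ofReal_ne_top
    _ = ENNReal.ofReal c * ∫⁻ u in φ '' S, kq M (u - α) := by rw [hcv]
    _ ≤ ENNReal.ofReal c * ENNReal.ofReal (2 / M) := by
        gcongr
        exact (setLIntegral_le_lintegral _ _).trans (lint_kq hM α)
    _ = _ := by rw [← ENNReal.ofReal_mul hc]

/-- The exceptional region. -/
def regB (X ξ ξ₁ : ℝ) : Prop := 8 * X < |ξ| ∧ |ξ - 2 * ξ₁| < 2 * X

lemma deriv1 (β ξ x : ℝ) : HasDerivAt (fun x => Phi β ξ x (ξ - x))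
    (ξ * (2 * x - ξ) * (5 * (x ^ 2 + (ξ - x) ^ 2) + 3 * β)) x := by
  unfold Phi
  have h1 := (hasDerivAt_id' x)
  have h2 := (hasDerivAt_id' x).const_sub ξ
  refine ((((h1.pow 5).add (h2.pow 5)).sub_const (ξ ^ 5)).add
    ((((h1.pow 3).add (h2.pow 3)).sub_const (ξ ^ 3)).const_mul β)).congr_deriv ?_
  push_cast
  ring

lemma deriv2 (β x ξ : ℝ) : HasDerivAt (fun ξ => Phi β ξ x (ξ - x))
    (((ξ - x) ^ 2 - ξ ^ 2) * (5 * ((ξ - x) ^ 2 + ξ ^ 2) + 3 * β)) ξ := by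
  unfold Phi
  have h1 := (hasDerivAt_id' ξ)
  have h2 := (hasDerivAt_id' ξ).sub_const x
  refine ((((h2.pow 5).const_add (x ^ 5)).sub (h1.pow 5)).add
    ((((h2.pow 3).const_add (x ^ 3)).sub (h1.pow 3)).const_mul β)).congr_deriv ?_
  push_cast
  ring

lemma lowA (β ξ x : ℝ) (h : 2 * (1 + |β|) ≤ |2 * x - ξ|) :
    ξ ^ 2 ≤ 1 * |ξ * (2 * x - ξ) * (5 * (x ^ 2 + (ξ - x) ^ 2) + 3 * β)| := by
  have hb := abs_nonneg β
  have hb' := neg_abs_le β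
  have h2 : (2 * (1 + |β|)) ^ 2 ≤ (2 * x - ξ) ^ 2 := by
    rw [← sq_abs (2 * x - ξ)]; gcongr
  have h3 : |ξ| ≤ 5 * (x ^ 2 + (ξ - x) ^ 2) + 3 * β := by
    have : x ^ 2 + (ξ - x) ^ 2 = ξ ^ 2 / 2 + (2 * x - ξ) ^ 2 / 2 := by ring
    rw [this]
    nlinarith [sq_nonneg (|ξ| - 1), sq_abs ξ, sq_nonneg |β|]
  rw [one_mul, abs_mul, abs_mul, ← sq_abs ξ]
  have h4 := h3.trans (le_abs_self _)
  have h5 : 1 ≤ |2 * x - ξ| := by linarith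
  calc |ξ| ^ 2 = |ξ| * 1 * |ξ| := by ring
    _ ≤ _ := by gcongr

lemma lowB (β x ξ : ℝ) (h : regB (1 + |β|) ξ x) :
    ξ ^ 2 ≤ 2 * |((ξ - x) ^ 2 - ξ ^ 2) * (5 * ((ξ - x) ^ 2 + ξ ^ 2) + 3 * β)| := by
  obtain ⟨h1, h2⟩ := h
  have hb := abs_nonneg β
  have hb' := neg_abs_le β
  have h3 : |ξ - x| ≤ 5 / 8 * |ξ| := by
    have : ξ - x = (1 / 2) * ξ + (1 / 2) * (ξ - 2 * x) := by ring
    rw [this]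
    refine (abs_add_le _ _).trans ?_
    rw [abs_mul, abs_mul, abs_of_pos (by norm_num : (0 : ℝ) < 1 / 2)]
    linarith
  have h4 : (ξ - x) ^ 2 ≤ 25 / 64 * ξ ^ 2 := by
    rw [← sq_abs (ξ - x), ← sq_abs ξ]
    have := pow_le_pow_left₀ (abs_nonneg _) h3 2
    linarith
  have h6 : 64 * (1 + |β|) ^ 2 ≤ ξ ^ 2 := by
    rw [← sq_abs ξ]
    have := pow_le_pow_left₀ (by positivity) h1.le 2
    linarith
  have h5 : 1 ≤ 5 * ((ξ - x) ^ 2 + ξ ^ 2) + 3 * β := by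
    nlinarith [sq_nonneg (ξ - x), sq_nonneg |β|]
  rw [abs_mul]
  have h7 : ξ ^ 2 / 2 ≤ |(ξ - x) ^ 2 - ξ ^ 2| := by
    rw [abs_sub_comm]
    refine le_trans ?_ (le_abs_self _)
    nlinarith [sq_nonneg ξ]
  have h8 := h5.trans (le_abs_self _)
  calc ξ ^ 2 = 2 * (ξ ^ 2 / 2 * 1) := by ring
    _ ≤ _ := by gcongr

lemma intA (β α ξ : ℝ) {M : ℝ} (hM : 1 ≤ M) :
    ∫⁻ x in {x | ¬ regB (1 + |β|) ξ x}, ENNReal.ofReal (ξ ^ 2) * kq M (Phi β ξ x (ξ - x) - α)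
      ≤ ENNReal.ofReal ((4 + 2 * (1 + |β|) * (8 * (1 + |β|)) ^ 2) / M) := by
  rcases eq_or_ne ξ 0 with h0 | h0
  · simp [h0]
  have hX : 0 < 1 + |β| := by positivity
  set X := 1 + |β| with hXd
  have hpos : 0 < ξ ^ 2 := by positivity
  set G : ℝ → ENNReal := fun x => ENNReal.ofReal (ξ ^ 2) * kq M (Phi β ξ x (ξ - x) - α) with hG
  have i1 : ∫⁻ x in Set.Ici (ξ / 2 + X), G x ≤ ENNReal.ofReal (1 * (2 / M)) := by
    refine one_dim hM α 1 zero_le_one _ Set.ordConnected_Ici (fun x => Phi β ξ x (ξ - x)) _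
      (fun _ => ξ ^ 2) (deriv1 β ξ) (fun _ _ => hpos) ?_
    intro x hx
    apply lowA
    refine le_trans ?_ (le_abs_self _)
    have := Set.mem_Ici.1 hx
    linarith
  have i2 : ∫⁻ x in Set.Iic (ξ / 2 - X), G x ≤ ENNReal.ofReal (1 * (2 / M)) := by
    refine one_dim hM α 1 zero_le_one _ Set.ordConnected_Iic (fun x => Phi β ξ x (ξ - x)) _
      (fun _ => ξ ^ 2) (deriv1 β ξ) (fun _ _ => hpos) ?_
    intro x hx
    apply lowA
    refine le_trans ?_ (neg_le_abs _)
    have := Set.mem_Iic.1 hx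
    linarith
  by_cases hR : |ξ| ≤ 8 * X
  · have i3 : ∫⁻ x in Set.Ioo (ξ / 2 - X) (ξ / 2 + X), G x
        ≤ ENNReal.ofReal (2 * X * (8 * X) ^ 2 / M) := by
      calc _ ≤ ∫⁻ x in Set.Ioo (ξ / 2 - X) (ξ / 2 + X),
              ENNReal.ofReal ((8 * X) ^ 2) * ENNReal.ofReal (1 / M) := by
            refine lintegral_mono fun x => ?_
            simp only [hG]
            refine mul_le_mul' (ENNReal.ofReal_le_ofReal ?_) (kq_le hM _)
            rw [← sq_abs ξ]; gcongr
        _ = _ := by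
            rw [lintegral_const, Measure.restrict_apply_univ, Real.volume_Ioo,
              ← ENNReal.ofReal_mul (by positivity), ← ENNReal.ofReal_mul (by positivity)]
            congr 1
            ring
    calc _ ≤ ∫⁻ x in Set.Ici (ξ / 2 + X) ∪ (Set.Iic (ξ / 2 - X) ∪
                Set.Ioo (ξ / 2 - X) (ξ / 2 + X)), G x := by
          apply lintegral_mono_set
          intro x _
          simp only [Set.mem_union, Set.mem_Ici, Set.mem_Iic, Set.mem_Ioo]
          by_cases ha : ξ / 2 + X ≤ x
          · exact Or.inl ha
          · by_cases hb : x ≤ ξ / 2 - X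
            · exact Or.inr (Or.inl hb)
            · exact Or.inr (Or.inr ⟨not_le.1 hb, not_le.1 ha⟩)
      _ ≤ ENNReal.ofReal (1 * (2 / M)) + (ENNReal.ofReal (1 * (2 / M)) +
            ENNReal.ofReal (2 * X * (8 * X) ^ 2 / M)) := by
          refine (lintegral_union_le _ _ _).trans (add_le_add i1 ?_)
          exact (lintegral_union_le _ _ _).trans (add_le_add i2 i3)
      _ = _ := by
          rw [← ENNReal.ofReal_add (by positivity) (by positivity),
            ← ENNReal.ofReal_add (by positivity) (by positivity)]
          congr 1
          ring
  · calc _ ≤ ∫⁻ x in Set.Ici (ξ / 2 + X) ∪ Set.Iic (ξ / 2 - X), G x := by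
          apply lintegral_mono_set
          intro x hx
          have hx : ¬ (8 * X < |ξ| ∧ |ξ - 2 * x| < 2 * X) := hx
          simp only [Set.mem_union, Set.mem_Ici, Set.mem_Iic]
          by_contra hcon
          push Not at hcon
          refine hx ⟨not_le.1 hR, abs_lt.2 ⟨?_, ?_⟩⟩ <;> linarith
      _ ≤ ENNReal.ofReal (1 * (2 / M)) + (ENNReal.ofReal (1 * (2 / M))) := by
          exact (lintegral_union_le _ _ _).trans (add_le_add i1 i2)
      _ ≤ _ := by
          rw [← ENNReal.ofReal_add (by positivity) (by positivity)]
          apply ENNReal.ofReal_le_ofReal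
          have : 0 ≤ 2 * X * (8 * X) ^ 2 / M := by positivity
          calc _ = 4 / M := by ring
            _ ≤ 4 / M + 2 * X * (8 * X) ^ 2 / M := by linarith
            _ = _ := by ring

lemma intB (β α x : ℝ) {M : ℝ} (hM : 1 ≤ M) :
    ∫⁻ ξ in {ξ | regB (1 + |β|) ξ x}, ENNReal.ofReal (ξ ^ 2) * kq M (Phi β ξ x (ξ - x) - α)
      ≤ ENNReal.ofReal (8 / M) := by
  set X := 1 + |β| with hXd
  have hX : 0 < X := by positivity
  have i1 : ∀ S : Set ℝ, S.OrdConnected → (∀ ξ ∈ S, regB X ξ x) →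
      ∫⁻ ξ in S, ENNReal.ofReal (ξ ^ 2) * kq M (Phi β ξ x (ξ - x) - α)
        ≤ ENNReal.ofReal (2 * (2 / M)) := by
    intro S hS hB
    refine one_dim hM α 2 zero_le_two _ hS (fun ξ => Phi β ξ x (ξ - x)) _
      (fun ξ => ξ ^ 2) (deriv2 β x) ?_ ?_
    · intro ξ hξ
      have h1 : 0 < |ξ| := by have := (hB ξ hξ).1; linarith
      have := abs_pos.1 h1
      positivity
    · intro ξ hξ
      exact lowB β x ξ (hB ξ hξ)
  calc _ ≤ ∫⁻ ξ in (Set.Ioi (8 * X) ∩ Set.Ioo (2 * x - 2 * X) (2 * x + 2 * X)) ∪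
          (Set.Iio (-(8 * X)) ∩ Set.Ioo (2 * x - 2 * X) (2 * x + 2 * X)),
            ENNReal.ofReal (ξ ^ 2) * kq M (Phi β ξ x (ξ - x) - α) := by
        apply lintegral_mono_set
        rintro ξ ⟨h1, h2⟩
        have h2 := abs_lt.1 h2
        have h3 : ξ ∈ Set.Ioo (2 * x - 2 * X) (2 * x + 2 * X) := ⟨by linarith, by linarith⟩
        rcases lt_abs.1 h1 with h | h
        · exact Or.inl ⟨h, h3⟩
        · exact Or.inr ⟨by simp only [Set.mem_Iio]; linarith, h3⟩
    _ ≤ ENNReal.ofReal (2 * (2 / M)) + ENNReal.ofReal (2 * (2 / M)) := by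
        refine (lintegral_union_le _ _ _).trans (add_le_add (i1 _ ?_ ?_) (i1 _ ?_ ?_))
        · exact Set.ordConnected_Ioi.inter Set.ordConnected_Ioo
        · rintro ξ ⟨h1, h2, h3⟩
          refine ⟨lt_abs.2 (Or.inl h1), abs_lt.2 ⟨?_, ?_⟩⟩ <;> linarith
        · exact Set.ordConnected_Iio.inter Set.ordConnected_Ioo
        · rintro ξ ⟨h1, h2, h3⟩
          have := Set.mem_Iio.1 h1
          refine ⟨lt_abs.2 (Or.inr (by linarith)), abs_lt.2 ⟨?_, ?_⟩⟩ <;> linarith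
    _ = _ := by
        rw [← ENNReal.ofReal_add (by positivity) (by positivity)]
        congr 1
        ring

/-- The absolute value of the kernel of `Iop`. -/
noncomputable def ker (β α M ξ x : ℝ) : ENNReal :=
  if M < |Phi β ξ x (ξ - x) - α| then ENNReal.ofReal (|ξ| / |Phi β ξ x (ξ - x) - α|) else 0

lemma Phi_cont (β : ℝ) : Continuous (fun p : ℝ × ℝ => Phi β p.1 p.2 (p.1 - p.2)) := by
  unfold Phi
  fun_prop

lemma ker_meas (β α M : ℝ) : Measurable (fun p : ℝ × ℝ => ker β α M p.1 p.2) := by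
  have h := (Phi_cont β).measurable
  unfold ker
  refine Measurable.ite ?_ (by fun_prop) measurable_const
  exact measurableSet_lt measurable_const (by fun_prop)

lemma ker_sq (β α M ξ x : ℝ) :
    ker β α M ξ x ^ 2 = ENNReal.ofReal (ξ ^ 2) * kq M (Phi β ξ x (ξ - x) - α) := by
  unfold ker kq
  split_ifs with h
  · rw [← ENNReal.ofReal_pow (by positivity), ← ENNReal.ofReal_mul (by positivity), div_pow,
      sq_abs, sq_abs]
    congr 1
    ring
  · simp

lemma cs {F G : ℝ → ENNReal} (hF : Measurable F) (hG : Measurable G) :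
    (∫⁻ x, F x * G x) ^ 2 ≤ (∫⁻ x, F x ^ 2) * ∫⁻ x, G x ^ 2 := by
  have h := ENNReal.lintegral_mul_le_Lp_mul_Lq volume Real.HolderConjugate.two_two
    hF.aemeasurable hG.aemeasurable
  simp only [Pi.mul_apply, ENNReal.rpow_two] at h
  have h2 := pow_le_pow_left' h 2
  refine h2.trans (le_of_eq ?_)
  rw [mul_pow, ← ENNReal.rpow_two, ← ENNReal.rpow_two, ← ENNReal.rpow_mul, ← ENNReal.rpow_mul]
  norm_num

lemma sq_add_le (a b : ENNReal) : (a + b) ^ 2 ≤ 2 * (a ^ 2 + b ^ 2) := by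
  have := ENNReal.rpow_add_le_mul_rpow_add_rpow a b one_le_two
  norm_num at this
  exact this

lemma regB_meas (X : ℝ) : MeasurableSet {p : ℝ × ℝ | regB X p.1 p.2} := by
  unfold regB
  have h1 : Measurable (fun p : ℝ × ℝ => |p.1|) := by fun_prop
  have h2 : Measurable (fun p : ℝ × ℝ => |p.1 - 2 * p.2|) := by fun_prop
  exact (measurableSet_lt measurable_const h1).inter (measurableSet_lt h2 measurable_const)

/-- Fixed-output Cauchy-Schwarz. -/
lemma bilA (k : ℝ → ℝ → ENNReal) (hk : Measurable (fun p : ℝ × ℝ => k p.1 p.2)) (c : ENNReal)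
    (hc : ∀ ξ, ∫⁻ x, k ξ x ^ 2 ≤ c) (F G : ℝ → ENNReal) (hF : Measurable F) (hG : Measurable G) :
    ∫⁻ ξ, (∫⁻ x, k ξ x * (F x * G (ξ - x))) ^ 2 ≤ c * ((∫⁻ x, F x ^ 2) * ∫⁻ x, G x ^ 2) := by
  have hk1 : ∀ ξ, Measurable (k ξ) := fun ξ => hk.comp measurable_prodMk_left
  have hm : Measurable (fun p : ℝ × ℝ => F p.2 ^ 2 * G (p.1 - p.2) ^ 2) := by fun_prop
  calc _ ≤ ∫⁻ ξ, c * ∫⁻ x, F x ^ 2 * G (ξ - x) ^ 2 := by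
        refine lintegral_mono fun ξ => ?_
        refine (cs (hk1 ξ) (by fun_prop)).trans ?_
        refine mul_le_mul' (hc ξ) (le_of_eq ?_)
        simp only [mul_pow]
    _ = c * ∫⁻ ξ, ∫⁻ x, F x ^ 2 * G (ξ - x) ^ 2 :=
        lintegral_const_mul _ hm.lintegral_prod_right'
    _ = c * ∫⁻ x, ∫⁻ ξ, F x ^ 2 * G (ξ - x) ^ 2 := by
        rw [lintegral_lintegral_swap hm.aemeasurable]
    _ = c * ∫⁻ x, F x ^ 2 * ∫⁻ y, G y ^ 2 := by
        congr 1
        refine lintegral_congr fun x => ?_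
        rw [lintegral_const_mul _ (by fun_prop), lintegral_sub_right_eq_self (fun y => G y ^ 2) x]
    _ = _ := by rw [lintegral_mul_const _ (by fun_prop)]

/-- Fixed-input Cauchy-Schwarz. -/
lemma bilB (k : ℝ → ℝ → ENNReal) (hk : Measurable (fun p : ℝ × ℝ => k p.1 p.2)) (c : ENNReal)
    (hc : ∀ x, ∫⁻ ξ, k ξ x ^ 2 ≤ c) (F G : ℝ → ENNReal) (hF : Measurable F) (hG : Measurable G) :
    ∫⁻ ξ, (∫⁻ x, k ξ x * (F x * G (ξ - x))) ^ 2 ≤ c * ((∫⁻ x, F x ^ 2) * ∫⁻ x, G x ^ 2) := by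
  have hk1 : ∀ ξ, Measurable (k ξ) := fun ξ => hk.comp measurable_prodMk_left
  have hk2 : ∀ x, Measurable (fun ξ => k ξ x) := fun ξ => hk.comp measurable_prodMk_right
  have hm : Measurable (fun p : ℝ × ℝ => k p.1 p.2 ^ 2 * F p.2 ^ 2) := by fun_prop
  calc _ ≤ ∫⁻ ξ, (∫⁻ x, k ξ x ^ 2 * F x ^ 2) * ∫⁻ y, G y ^ 2 := by
        refine lintegral_mono fun ξ => ?_
        have hk1' := hk1 ξ
        have := cs (F := fun x => k ξ x * F x) (G := fun x => G (ξ - x)) (by fun_prop) (by fun_prop)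
        rw [lintegral_sub_left_eq_self (fun y => G y ^ 2) ξ] at this
        simpa only [mul_pow, mul_assoc] using this
    _ = (∫⁻ ξ, ∫⁻ x, k ξ x ^ 2 * F x ^ 2) * ∫⁻ y, G y ^ 2 :=
        lintegral_mul_const _ hm.lintegral_prod_right'
    _ = (∫⁻ x, ∫⁻ ξ, k ξ x ^ 2 * F x ^ 2) * ∫⁻ y, G y ^ 2 := by
        rw [lintegral_lintegral_swap hm.aemeasurable]
    _ ≤ (∫⁻ x, c * F x ^ 2) * ∫⁻ y, G y ^ 2 := by
        gcongr with x
        have hk2' := hk2 x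
        rw [lintegral_mul_const _ (by fun_prop)]
        gcongr
        exact hc x
    _ = _ := by rw [lintegral_const_mul _ (by fun_prop), mul_assoc]

/-- The positive bilinear form. -/
noncomputable def Tpos (β α M : ℝ) (F G : ℝ → ENNReal) (ξ : ℝ) : ENNReal :=
  ∫⁻ x, ker β α M ξ x * (F x * G (ξ - x))

/-- The constant. -/
noncomputable def C0 (β : ℝ) : ℝ := 2 * ((4 + 2 * (1 + |β|) * (8 * (1 + |β|)) ^ 2) + 8)

lemma C0_pos (β : ℝ) : 0 < C0 β := by unfold C0; positivity

open Classical in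
lemma Tpos_bound (β α : ℝ) {M : ℝ} (hM : 1 ≤ M) (F G : ℝ → ENNReal) (hF : Measurable F)
    (hG : Measurable G) :
    ∫⁻ ξ, Tpos β α M F G ξ ^ 2
      ≤ ENNReal.ofReal (C0 β / M) * ((∫⁻ x, F x ^ 2) * ∫⁻ x, G x ^ 2) := by
  have hB := regB_meas (1 + |β|)
  set kA : ℝ → ℝ → ENNReal := fun ξ x => if regB (1 + |β|) ξ x then 0 else ker β α M ξ x with hkA
  set kB : ℝ → ℝ → ENNReal := fun ξ x => if regB (1 + |β|) ξ x then ker β α M ξ x else 0 with hkB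
  have mA : Measurable (fun p : ℝ × ℝ => kA p.1 p.2) :=
    Measurable.ite hB measurable_const (ker_meas β α M)
  have mB : Measurable (fun p : ℝ × ℝ => kB p.1 p.2) :=
    Measurable.ite hB (ker_meas β α M) measurable_const
  have hsum : ∀ ξ x, ker β α M ξ x = kA ξ x + kB ξ x := by
    intro ξ x
    simp only [hkA, hkB]
    split_ifs <;> simp
  have cA : ∀ ξ, ∫⁻ x, kA ξ x ^ 2
      ≤ ENNReal.ofReal ((4 + 2 * (1 + |β|) * (8 * (1 + |β|)) ^ 2) / M) := by
    intro ξ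
    refine le_trans (le_of_eq ?_) (intA β α ξ hM)
    have hms : MeasurableSet {x | ¬ regB (1 + |β|) ξ x} :=
      (measurable_prodMk_left (x := ξ) hB).compl
    rw [← lintegral_indicator hms]
    refine lintegral_congr fun x => ?_
    by_cases h : regB (1 + |β|) ξ x <;> simp [hkA, Set.indicator, h, ker_sq]
  have cB : ∀ x, ∫⁻ ξ, kB ξ x ^ 2 ≤ ENNReal.ofReal (8 / M) := by
    intro x
    refine le_trans (le_of_eq ?_) (intB β α x hM)
    have hms : MeasurableSet {ξ | regB (1 + |β|) ξ x} :=
      (measurable_prodMk_right (y := x) hB)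
    rw [← lintegral_indicator hms]
    refine lintegral_congr fun ξ => ?_
    by_cases h : regB (1 + |β|) ξ x <;> simp [hkB, Set.indicator, h, ker_sq]
  have bA := bilA kA mA _ cA F G hF hG
  have bB := bilB kB mB _ cB F G hF hG
  have mTA : Measurable (fun ξ => ∫⁻ x, kA ξ x * (F x * G (ξ - x))) := by
    have : Measurable (fun p : ℝ × ℝ => kA p.1 p.2 * (F p.2 * G (p.1 - p.2))) := by fun_prop
    exact this.lintegral_prod_right'
  calc _ ≤ ∫⁻ ξ, 2 * ((∫⁻ x, kA ξ x * (F x * G (ξ - x))) ^ 2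
              + (∫⁻ x, kB ξ x * (F x * G (ξ - x))) ^ 2) := by
        refine lintegral_mono fun ξ => ?_
        refine le_trans (le_of_eq ?_) (sq_add_le _ _)
        have h1 : Measurable (kA ξ) := mA.comp measurable_prodMk_left
        rw [← lintegral_add_left (by fun_prop)]
        unfold Tpos
        simp only [hsum, add_mul]
    _ = 2 * ((∫⁻ ξ, (∫⁻ x, kA ξ x * (F x * G (ξ - x))) ^ 2)
              + ∫⁻ ξ, (∫⁻ x, kB ξ x * (F x * G (ξ - x))) ^ 2) := by
        rw [lintegral_const_mul' _ _ (by norm_num), lintegral_add_left (by fun_prop)]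
    _ ≤ _ := mul_le_mul' le_rfl (add_le_add bA bB)
    _ = _ := by
        rw [← add_mul, ← ENNReal.ofReal_add (by positivity) (by positivity), ← mul_assoc]
        congr 1
        rw [show (2 : ENNReal) = ENNReal.ofReal 2 by simp, ← ENNReal.ofReal_mul (by norm_num)]
        congr 1
        unfold C0
        ring

lemma Tpos_meas (β α M : ℝ) (F G : ℝ → ENNReal) (hF : Measurable F) (hG : Measurable G) :
    Measurable (Tpos β α M F G) := by
  have hk := ker_meas β α M
  have : Measurable (fun p : ℝ × ℝ => ker β α M p.1 p.2 * (F p.2 * G (p.1 - p.2))) := by fun_prop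
  exact this.lintegral_prod_right'

/-- The weight. -/
noncomputable def wt (s ξ : ℝ) : ENNReal := ENNReal.ofReal ((1 + ξ ^ 2) ^ (s / 2))

lemma wt_meas (s : ℝ) : Measurable (wt s) := by unfold wt; fun_prop

/-- The weighted modulus. -/
noncomputable def Wf (s : ℝ) (f : ℝ → ℂ) (ξ : ℝ) : ENNReal := wt s ξ * ‖f ξ‖ₑ

lemma Wf_meas (s : ℝ) {f : ℝ → ℂ} (hf : Measurable f) : Measurable (Wf s f) := by
  have := wt_meas s
  unfold Wf
  fun_prop

lemma Wf_sq (s : ℝ) (f : ℝ → ℂ) (ξ : ℝ) :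
    Wf s f ξ ^ 2 = ENNReal.ofReal ((1 + ξ ^ 2) ^ s * ‖f ξ‖ ^ 2) := by
  unfold Wf wt
  have h0 : 0 ≤ 1 + ξ ^ 2 := by positivity
  rw [← ofReal_norm, ← ENNReal.ofReal_mul (by positivity),
    ← ENNReal.ofReal_pow (by positivity), mul_pow, ← Real.rpow_natCast, ← Real.rpow_mul h0]
  norm_num

lemma peetre {s : ℝ} (hs : 0 ≤ s) (ξ x : ℝ) :
    wt s ξ ≤ ENNReal.ofReal (2 ^ (s / 2)) * (wt s x * wt s (ξ - x)) := by
  unfold wt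
  rw [← ENNReal.ofReal_mul (by positivity), ← ENNReal.ofReal_mul (by positivity)]
  apply ENNReal.ofReal_le_ofReal
  rw [← Real.mul_rpow (by positivity) (by positivity),
    ← Real.mul_rpow (by positivity) (by positivity)]
  apply Real.rpow_le_rpow (by positivity) _ (by positivity)
  nlinarith [sq_nonneg (ξ - 2 * x), sq_nonneg (x * (ξ - x)), sq_nonneg ξ]

/-- The integrand of `Iop`. -/
noncomputable def igd (β t α M : ℝ) (h₁ h₂ : ℝ → ℂ) (ξ ξ₁ : ℝ) : ℂ :=
    if M < |Phi β ξ ξ₁ (ξ - ξ₁) - α| then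
      Complex.I * (ξ : ℂ)
        * (Complex.exp (Complex.I * (t : ℂ) * ((Phi β ξ ξ₁ (ξ - ξ₁) : ℝ) : ℂ))
            / ((Phi β ξ ξ₁ (ξ - ξ₁) - α : ℝ) : ℂ))
        * h₁ ξ₁ * h₂ (ξ - ξ₁)
    else 0

lemma Iop_eq (β t α M : ℝ) (h₁ h₂ : ℝ → ℂ) (ξ : ℝ) :
    Iop β t α M h₁ h₂ ξ = ∫ x, igd β t α M h₁ h₂ ξ x := by
  unfold Iop igd
  rfl

lemma slice_meas (k : ℝ → ℝ → ENNReal) (hk : Measurable (fun p : ℝ × ℝ => k p.1 p.2)) (ξ : ℝ) :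
    Measurable (k ξ) := hk.comp measurable_prodMk_left

lemma ker_meas' (β α M ξ : ℝ) : Measurable (fun x => ker β α M ξ x) :=
  slice_meas (ker β α M) (ker_meas β α M) ξ

lemma igd_split (β t α M : ℝ) (f g : ℝ → ℂ) (ξ x : ℝ) :
    igd β t α M f f ξ x - igd β t α M g g ξ x
      = igd β t α M (fun ξ => f ξ - g ξ) f ξ x + igd β t α M g (fun ξ => f ξ - g ξ) ξ x := by
  unfold igd
  generalize Phi β ξ x (ξ - x) = P
  split_ifs
  · ring
  · ring

lemma igd_enorm (β t α M : ℝ) (h₁ h₂ : ℝ → ℂ) (ξ x : ℝ) :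
    ‖igd β t α M h₁ h₂ ξ x‖ₑ ≤ ker β α M ξ x * (‖h₁ x‖ₑ * ‖h₂ (ξ - x)‖ₑ) := by
  unfold igd ker
  split_ifs with h
  · have he : ‖Complex.exp (Complex.I * (t : ℂ) * ((Phi β ξ x (ξ - x) : ℝ) : ℂ))‖ = 1 := by
      rw [mul_assoc, ← Complex.ofReal_mul, Complex.norm_exp_I_mul_ofReal]
    rw [enorm_mul, enorm_mul, mul_assoc, ← ofReal_norm]
    gcongr
    rw [norm_mul, norm_mul, norm_div, he, Complex.norm_I, Complex.norm_real, Complex.norm_real,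
      Real.norm_eq_abs, Real.norm_eq_abs]
    apply le_of_eq; ring
  · simp

lemma ker_le (β α ξ x : ℝ) {M : ℝ} (hM : 1 ≤ M) : ker β α M ξ x ≤ ENNReal.ofReal |ξ| := by
  unfold ker
  split_ifs with h
  · apply ENNReal.ofReal_le_ofReal
    exact div_le_self (abs_nonneg _) (by linarith)
  · exact zero_le

lemma igd_meas (β t α M : ℝ) {h₁ h₂ : ℝ → ℂ} (m₁ : Measurable h₁) (m₂ : Measurable h₂) (ξ : ℝ) :
    Measurable (igd β t α M h₁ h₂ ξ) := by
  have hP : Measurable (fun x => Phi β ξ x (ξ - x)) := by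
    unfold Phi
    fun_prop
  unfold igd
  refine Measurable.ite ?_ (by fun_prop) measurable_const
  exact measurableSet_lt measurable_const (by fun_prop)

lemma L2_of_weighted {s : ℝ} (hs : 0 ≤ s) {f : ℝ → ℂ}
    (h : Integrable (fun ξ : ℝ => (1 + ξ ^ 2) ^ s * ‖f ξ‖ ^ 2)) : ∫⁻ ξ, ‖f ξ‖ₑ ^ 2 < ⊤ := by
  refine lt_of_le_of_lt (lintegral_mono fun ξ => ?_) h.lintegral_lt_top
  rw [← ofReal_norm, ← ENNReal.ofReal_pow (by positivity)]
  apply ENNReal.ofReal_le_ofReal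
  have : 1 ≤ (1 + ξ ^ 2) ^ s := Real.one_le_rpow (by nlinarith [sq_nonneg ξ]) hs
  nlinarith [sq_nonneg ‖f ξ‖]

lemma igd_int (β t α : ℝ) {M : ℝ} (hM : 1 ≤ M) {h₁ h₂ : ℝ → ℂ} (m₁ : Measurable h₁)
    (m₂ : Measurable h₂) (i₁ : ∫⁻ ξ, ‖h₁ ξ‖ₑ ^ 2 < ⊤) (i₂ : ∫⁻ ξ, ‖h₂ ξ‖ₑ ^ 2 < ⊤) (ξ : ℝ) :
    Integrable (igd β t α M h₁ h₂ ξ) := by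
  refine ⟨(igd_meas β t α M m₁ m₂ ξ).aestronglyMeasurable, ?_⟩
  have hcs := cs (F := fun x => ‖h₁ x‖ₑ) (G := fun x => ‖h₂ (ξ - x)‖ₑ) (by fun_prop) (by fun_prop)
  rw [lintegral_sub_left_eq_self (fun y => ‖h₂ y‖ₑ ^ 2) ξ] at hcs
  have h2 : (∫⁻ x, ‖h₁ x‖ₑ * ‖h₂ (ξ - x)‖ₑ) ^ 2 < ⊤ := hcs.trans_lt (ENNReal.mul_lt_top i₁ i₂)
  have h3 : ∫⁻ x, ‖h₁ x‖ₑ * ‖h₂ (ξ - x)‖ₑ < ⊤ := by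
    by_contra hcon
    rw [not_lt, top_le_iff] at hcon
    rw [hcon] at h2
    simp at h2
  unfold HasFiniteIntegral
  calc _ ≤ ∫⁻ x, ENNReal.ofReal |ξ| * (‖h₁ x‖ₑ * ‖h₂ (ξ - x)‖ₑ) := by
        refine lintegral_mono fun x => (igd_enorm β t α M h₁ h₂ ξ x).trans ?_
        gcongr
        exact ker_le β α ξ x hM
    _ = ENNReal.ofReal |ξ| * ∫⁻ x, (‖h₁ x‖ₑ * ‖h₂ (ξ - x)‖ₑ) :=
        lintegral_const_mul' _ _ ENNReal.ofReal_ne_top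
    _ < ⊤ := ENNReal.mul_lt_top ENNReal.ofReal_lt_top h3

lemma pointwise {s : ℝ} (hs : 0 ≤ s) (β t α : ℝ) {M : ℝ} (hM : 1 ≤ M) {f g : ℝ → ℂ}
    (mf : Measurable f) (mg : Measurable g) (hf : ∫⁻ ξ, ‖f ξ‖ₑ ^ 2 < ⊤)
    (hg : ∫⁻ ξ, ‖g ξ‖ₑ ^ 2 < ⊤) (ξ : ℝ) :
    Wf s (fun ξ : ℝ => Iop β t α M f f ξ - Iop β t α M g g ξ) ξ
      ≤ ENNReal.ofReal (2 ^ (s / 2)) * (Tpos β α M (Wf s (fun ξ => f ξ - g ξ)) (Wf s f) ξ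
        + Tpos β α M (Wf s g) (Wf s (fun ξ => f ξ - g ξ)) ξ) := by
  have e1 : Iop β t α M f f ξ - Iop β t α M g g ξ
      = ∫ x, (igd β t α M (fun ξ => f ξ - g ξ) f ξ x + igd β t α M g (fun ξ => f ξ - g ξ) ξ x) := by
    rw [Iop_eq, Iop_eq, ← integral_sub (igd_int β t α hM mf mf hf hf ξ)
      (igd_int β t α hM mg mg hg hg ξ)]
    simp only [igd_split]
  have mW1 := Wf_meas s (f := fun ξ => f ξ - g ξ) (by fun_prop)
  have mWf := Wf_meas s mf
  have hk : Measurable (fun x => ker β α M ξ x) := ker_meas' β α M ξ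
  unfold Tpos
  rw [← lintegral_add_left (by fun_prop), ← lintegral_const_mul' _ _ ENNReal.ofReal_ne_top]
  unfold Wf
  simp only
  rw [e1]
  calc _ ≤ wt s ξ * ∫⁻ x, ‖igd β t α M (fun ξ => f ξ - g ξ) f ξ x
              + igd β t α M g (fun ξ => f ξ - g ξ) ξ x‖ₑ := by
        gcongr
        exact enorm_integral_le_lintegral_enorm _
    _ = ∫⁻ x, wt s ξ * ‖igd β t α M (fun ξ => f ξ - g ξ) f ξ x
              + igd β t α M g (fun ξ => f ξ - g ξ) ξ x‖ₑ :=
        (lintegral_const_mul' _ _ ENNReal.ofReal_ne_top).symm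
    _ ≤ _ := by
        refine lintegral_mono fun x => ?_
        have b1 := igd_enorm β t α M (fun ξ => f ξ - g ξ) f ξ x
        have b2 := igd_enorm β t α M g (fun ξ => f ξ - g ξ) ξ x
        refine (mul_le_mul' (peetre hs ξ x) ((enorm_add_le _ _).trans (add_le_add b1 b2))).trans ?_
        apply le_of_eq
        ring

lemma wnorm_sq (s : ℝ) {f : ℝ → ℂ} (mf : Measurable f) :
    wnorm s f ^ 2 = (∫⁻ ξ, Wf s f ξ ^ 2).toReal := by
  have h0 : 0 ≤ ∫ ξ : ℝ, (1 + ξ ^ 2) ^ s * ‖f ξ‖ ^ 2 :=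
    integral_nonneg fun ξ => by positivity
  unfold wnorm
  rw [← Real.sqrt_eq_rpow, Real.sq_sqrt h0, integral_eq_lintegral_of_nonneg_ae]
  · simp only [Wf_sq]
  · exact Filter.Eventually.of_forall fun ξ => by positivity
  · exact Measurable.aestronglyMeasurable (by fun_prop)

lemma wnorm_nonneg (s : ℝ) (f : ℝ → ℂ) : 0 ≤ wnorm s f :=
  Real.rpow_nonneg (integral_nonneg fun ξ => by positivity) _

lemma wnorm_le (s : ℝ) (f : ℝ → ℂ) : wnorm s f ≤ √(∫⁻ ξ, Wf s f ξ ^ 2).toReal := by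
  unfold wnorm
  rw [← Real.sqrt_eq_rpow]
  apply Real.sqrt_le_sqrt
  have h := norm_integral_le_lintegral_norm (μ := volume)
    (fun ξ : ℝ => (1 + ξ ^ 2) ^ s * ‖f ξ‖ ^ 2)
  refine (le_abs_self _).trans (h.trans (le_of_eq ?_))
  congr 1
  refine lintegral_congr fun ξ => ?_
  rw [Wf_sq, Real.norm_of_nonneg (by positivity)]

lemma Wf_fin {s : ℝ} {f : ℝ → ℂ}
    (h : Integrable (fun ξ : ℝ => (1 + ξ ^ 2) ^ s * ‖f ξ‖ ^ 2)) : ∫⁻ ξ, Wf s f ξ ^ 2 < ⊤ := by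
  simp only [Wf_sq]
  exact h.lintegral_lt_top

lemma Wf_sub_fin {s : ℝ} {f g : ℝ → ℂ} (mf : Measurable f)
    (hf : ∫⁻ ξ, Wf s f ξ ^ 2 < ⊤) (hg : ∫⁻ ξ, Wf s g ξ ^ 2 < ⊤) :
    ∫⁻ ξ, Wf s (fun ξ => f ξ - g ξ) ξ ^ 2 < ⊤ := by
  have m := Wf_meas s mf
  calc _ ≤ ∫⁻ ξ, 2 * (Wf s f ξ ^ 2 + Wf s g ξ ^ 2) := by
        refine lintegral_mono fun ξ => le_trans ?_ (sq_add_le _ _)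
        unfold Wf
        rw [← mul_add]
        gcongr
        exact enorm_sub_le
    _ = 2 * ((∫⁻ ξ, Wf s f ξ ^ 2) + ∫⁻ ξ, Wf s g ξ ^ 2) := by
        rw [lintegral_const_mul' _ _ (by norm_num), lintegral_add_left (by fun_prop)]
    _ < ⊤ := ENNReal.mul_lt_top (by norm_num) (ENNReal.add_lt_top.2 ⟨hf, hg⟩)

/-- Estimate (imd) of Proposition 3.1: the difference bound
`‖I^α_{>M}(f,f) − I^α_{>M}(g,g)‖_{H^s} ≲ M^{−1/2} ‖f − g‖_{H^s} (‖f‖_{H^s} + ‖g‖_{H^s})`. -/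
theorem kawahara_I_gtM_difference_estimate (s β : ℝ) (hs : 0 ≤ s) :
    ∃ C > 0, ∀ (t α M : ℝ), 1 ≤ M → ∀ f g : ℝ → ℂ,
      Measurable f → Measurable g →
      Integrable (fun ξ : ℝ => (1 + ξ ^ 2) ^ s * ‖f ξ‖ ^ 2) →
      Integrable (fun ξ : ℝ => (1 + ξ ^ 2) ^ s * ‖g ξ‖ ^ 2) →
      wnorm s (fun ξ : ℝ => Iop β t α M f f ξ - Iop β t α M g g ξ)
        ≤ C * M ^ (-(1 : ℝ) / 2) * wnorm s (fun ξ => f ξ - g ξ) * (wnorm s f + wnorm s g) := by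
  refine ⟨√(2 ^ s * 2 * C0 β), Real.sqrt_pos.2 (by have := C0_pos β; positivity), ?_⟩
  intro t α M hM f g mf mg hf hg
  have hC := C0_pos β
  have hM0 : 0 < M := by linarith
  have mh : Measurable (fun ξ => f ξ - g ξ) := by fun_prop
  have ff := Wf_fin hf
  have fg := Wf_fin hg
  have fh := Wf_sub_fin mf ff fg
  have nf := wnorm_sq s mf
  have ng := wnorm_sq s mg
  have nh := wnorm_sq s mh
  have pf := wnorm_nonneg s f
  have pg := wnorm_nonneg s g
  have ph := wnorm_nonneg s (fun ξ => f ξ - g ξ)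
  have pw := pointwise hs β t α hM mf mg (L2_of_weighted hs hf) (L2_of_weighted hs hg)
  have mWf := Wf_meas s mf
  have mWg := Wf_meas s mg
  have mWh := Wf_meas s mh
  have mT := Tpos_meas β α M _ _ mWh mWf
  have b1 := Tpos_bound β α hM _ _ mWh mWf
  have b2 := Tpos_bound β α hM _ _ mWg mWh
  set h : ℝ → ℂ := fun ξ => f ξ - g ξ with hh
  set D : ℝ → ℂ := fun ξ : ℝ => Iop β t α M f f ξ - Iop β t α M g g ξ with hD
  have main : ∫⁻ ξ, Wf s D ξ ^ 2 ≤ ENNReal.ofReal (2 ^ s * 2 * C0 β / M) *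
      ((∫⁻ ξ, Wf s h ξ ^ 2) * ((∫⁻ ξ, Wf s f ξ ^ 2) + ∫⁻ ξ, Wf s g ξ ^ 2)) := by
    calc _ ≤ ∫⁻ ξ, ENNReal.ofReal (2 ^ s) * (2 * (Tpos β α M (Wf s h) (Wf s f) ξ ^ 2
              + Tpos β α M (Wf s g) (Wf s h) ξ ^ 2)) := by
          refine lintegral_mono fun ξ => (pow_le_pow_left' (pw ξ) 2).trans ?_
          rw [mul_pow, ← ENNReal.ofReal_pow (by positivity), ← Real.rpow_natCast,
            ← Real.rpow_mul (by norm_num)]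
          norm_num only [Nat.cast_ofNat, div_mul_cancel₀]
          gcongr
          exact sq_add_le _ _
      _ = ENNReal.ofReal (2 ^ s) * (2 * ((∫⁻ ξ, Tpos β α M (Wf s h) (Wf s f) ξ ^ 2)
              + ∫⁻ ξ, Tpos β α M (Wf s g) (Wf s h) ξ ^ 2)) := by
          rw [lintegral_const_mul' _ _ ENNReal.ofReal_ne_top,
            lintegral_const_mul' _ _ (by norm_num), lintegral_add_left (by fun_prop)]
      _ ≤ _ := mul_le_mul' le_rfl (mul_le_mul' le_rfl (add_le_add b1 b2))
      _ = _ := by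
          rw [show 2 ^ s * 2 * C0 β / M = 2 ^ s * (2 * (C0 β / M)) by ring,
            ENNReal.ofReal_mul (by positivity), ENNReal.ofReal_mul (by positivity),
            ENNReal.ofReal_ofNat]
          ring
  have main2 := ENNReal.toReal_mono (ENNReal.mul_ne_top ENNReal.ofReal_ne_top
    (ENNReal.mul_ne_top fh.ne (ENNReal.add_ne_top.2 ⟨ff.ne, fg.ne⟩))) main
  rw [ENNReal.toReal_mul, ENNReal.toReal_mul, ENNReal.toReal_add ff.ne fg.ne,
    ENNReal.toReal_ofReal (by positivity), ← nf, ← ng, ← nh] at main2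
  refine (wnorm_le s D).trans ?_
  apply Real.sqrt_le_iff.2
  refine ⟨by positivity, main2.trans ?_⟩
  have e : (M ^ (-(1 : ℝ) / 2)) ^ 2 = M⁻¹ := by
    rw [← Real.rpow_natCast, ← Real.rpow_mul hM0.le, ← Real.rpow_neg_one]
    norm_num
  rw [mul_pow, mul_pow, mul_pow, e, Real.sq_sqrt (by positivity)]
  have : 2 ^ s * 2 * C0 β * M⁻¹ * wnorm s h ^ 2 * (wnorm s f + wnorm s g) ^ 2
      = 2 ^ s * 2 * C0 β / M * (wnorm s h ^ 2 * (wnorm s f + wnorm s g) ^ 2) := by ring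
  rw [this]
  gcongr
  nlinarith [mul_nonneg pf pg]
end
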